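/- arXiv:2108.06211 — 2 statements merged into one kernel-verified Lean document; each statement's English description precedes it below -/
import Mathlib

section
/- Suppose Assumptions A1–A3 hold. Then there exists a stationary process ((Y_t, X_t))_{t∈ℤ}, whose F-component is the given process X, satisfying the model equation ℙ(Y_t ∈ A | X, Y_{t-1}, Y_{t-2}, …) = P_{X_{t-1}}(Y_{t-1}, A) a.s. for every t ∈ ℤ and every Borel set A ⊆ E; moreover the distribution of such a process is unique, i.e., any two shift-invariant probability measures on (E×F)^ℤ whose F^ℤ-marginal is the law of X and which satisfy this conditional-distribution equation coincide. -/
open MeasureTheory ProbabilityTheory Filter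
open scoped ENNReal

noncomputable section

/-- The shift operator on two-sided paths. -/
def zshift {α : Type*} (x : ℤ → α) : ℤ → α := fun t => x (t + 1)

/-- The σ-algebra on the path space `(E × F)^ℤ` generated by the whole `F`-coordinate path
(environment) and the `E`-coordinates (chain) strictly before time `t`. -/
def histSigma (E F : Type*) [MeasurableSpace E] [MeasurableSpace F] (t : ℤ) :
    MeasurableSpace (ℤ → E × F) :=
  MeasurableSpace.comap
    (fun z => ((fun s => (z s).2, fun s : {s : ℤ // s < t} => (z s.1).1) :
      (ℤ → F) × ({s : ℤ // s < t} → E))) inferInstance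

/-- `μ` is the law of a process `((Y_t, X_t))_{t ∈ ℤ}` solving the Markov chain in random
environment model: `Pr(Y_t ∈ A | X, Y_{t-1}, Y_{t-2}, …) = P_{X_{t-1}}(Y_{t-1}, A)` a.s. -/
def IsMCRESolution {E F : Type*} [MeasurableSpace E] [MeasurableSpace F]
    (P : Kernel (F × E) E) (μ : Measure (ℤ → E × F)) : Prop :=
  ∀ (t : ℤ) (A : Set E), MeasurableSet A →
    μ[({z : ℤ → E × F | (z t).1 ∈ A}).indicator (fun _ => (1 : ℝ)) | histSigma E F t]
      =ᵐ[μ] fun z => (P ((z (t - 1)).2, (z (t - 1)).1) A).toReal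



/-- running maximum of partial sums -/
def runMax {α : Type*} (T : α → α) (f : α → ℝ) : ℕ → α → ℝ
  | 0 => fun _ => 0
  | n + 1 => fun x => max 0 (f x + runMax T f n (T x))

theorem runMax_nonneg {α : Type*} (T : α → α) (f : α → ℝ) (n : ℕ) (x : α) :
    0 ≤ runMax T f n x := by
  cases n <;> simp [runMax]

theorem runMax_succ {α : Type*} (T : α → α) (f : α → ℝ) (n : ℕ) :
    ∀ x : α, runMax T f n x ≤ runMax T f (n + 1) x := by
  induction n with
  | zero => intro x; simp [runMax]
  | succ n ih =>
    intro x
    rw [runMax, runMax]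
    exact max_le_max le_rfl (by linarith [ih (T x)])

theorem runMax_sum {α : Type*} (T : α → α) (f : α → ℝ) (n : ℕ) :
    ∀ x : α, ∑ i ∈ Finset.range n, f (T^[i] x) ≤ runMax T f n x := by
  induction n with
  | zero => intro x; simp [runMax]
  | succ n ih =>
    intro x
    rw [runMax, Finset.sum_range_succ']
    refine le_trans ?_ (le_max_right _ _)
    have := ih (T x)
    simp only [Function.iterate_succ_apply, Function.iterate_zero, id]
    linarith

theorem runMax_integrable {α : Type*} [MeasurableSpace α] (μ : Measure α)
    (T : α → α) (hT : MeasurePreserving T μ μ) (f : α → ℝ) (hf : Integrable f μ) (n : ℕ) :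
    Integrable (runMax T f n) μ := by
  induction n with
  | zero => exact integrable_zero _ _ _
  | succ n ih =>
    exact (integrable_zero _ _ _).sup (hf.add (hT.integrable_comp_of_integrable ih))

theorem runMax_measurable {α : Type*} [MeasurableSpace α]
    (T : α → α) (hT : Measurable T) (f : α → ℝ) (hf : Measurable f) (n : ℕ) :
    Measurable (runMax T f n) := by
  induction n with
  | zero => exact measurable_const
  | succ n ih =>
    exact measurable_const.max (hf.add (ih.comp hT))

theorem maximal_ineq {α : Type*} [MeasurableSpace α] (μ : Measure α) [IsProbabilityMeasure μ]
    (T : α → α) (hT : MeasurePreserving T μ μ) (φ : α → ℝ) (hφm : Measurable φ)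
    (hφ : Integrable φ μ) (h0 : ∀ x, 0 ≤ φ x) (c : ℝ) (n : ℕ) :
    c * μ.real {x | 0 < runMax T (fun x => φ x - c) n x} ≤ ∫ x, φ x ∂μ := by
  set f : α → ℝ := fun x => φ x - c with hf
  have hfi : Integrable f μ := hφ.sub (integrable_const c)
  have hfm : Measurable f := hφm.sub measurable_const
  set M := runMax T f n with hM
  have hMi : Integrable M μ := runMax_integrable μ T hT f hfi n
  have hMm : Measurable M := runMax_measurable T hT.measurable f hfm n
  have hs : MeasurableSet {x | 0 < M x} := measurableSet_lt measurable_const hMm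
  have key : ∀ x, M x - M (T x) ≤ ({x | 0 < M x}).indicator f x := by
    intro x
    by_cases hx : 0 < M x
    · rw [Set.indicator_of_mem (by exact hx)]
      have := runMax_succ T f n x
      rw [runMax] at this
      rcases le_max_iff.1 this with h | h
      · exact absurd hx (not_lt.2 h)
      · linarith
    · rw [Set.indicator_of_notMem (by exact hx)]
      have := runMax_nonneg T f n (T x)
      linarith
  have h1 : ∫ x, (M x - M (T x)) ∂μ = 0 := by
    have hMT : Integrable (fun x => M (T x)) μ := hT.integrable_comp_of_integrable hMi
    have h := integral_map (μ := μ) hT.measurable.aemeasurable (f := M)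
      (by exact hMm.aestronglyMeasurable)
    rw [hT.map_eq] at h
    rw [integral_sub hMi hMT, ← h, sub_self]
  have h2 : 0 ≤ ∫ x, ({x | 0 < M x}).indicator f x ∂μ := by
    refine h1.symm.le.trans ?_
    exact integral_mono (hMi.sub (hT.integrable_comp_of_integrable hMi)) (hfi.indicator hs) key
  rw [integral_indicator hs, integral_sub hφ.integrableOn (integrable_const c)] at h2
  rw [setIntegral_const, smul_eq_mul] at h2
  have h3 : ∫ x in {x | 0 < M x}, φ x ∂μ ≤ ∫ x, φ x ∂μ :=
    setIntegral_le_integral hφ (Eventually.of_forall h0)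
  linarith

theorem ae_sum_bounded {α : Type*} [MeasurableSpace α] (μ : Measure α) [IsProbabilityMeasure μ]
    (T : α → α) (hT : MeasurePreserving T μ μ) (φ : α → ℝ) (hφm : Measurable φ)
    (hφ : Integrable φ μ) (h0 : ∀ x, 0 ≤ φ x) :
    ∀ᵐ x ∂μ, ∃ C : ℝ, ∀ n : ℕ, ∑ i ∈ Finset.range n, φ (T^[i] x) ≤ C * n := by
  set I := ∫ x, φ x ∂μ with hI
  have hI0 : 0 ≤ I := integral_nonneg h0
  have step : ∀ c : ℝ, 0 < c →
      μ {x | ¬ ∃ C : ℝ, ∀ n : ℕ, ∑ i ∈ Finset.range n, φ (T^[i] x) ≤ C * n} ≤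
        ENNReal.ofReal (I / c) := by
    intro c hc
    have hsub : {x | ¬ ∃ C : ℝ, ∀ n : ℕ, ∑ i ∈ Finset.range n, φ (T^[i] x) ≤ C * n} ⊆
        ⋃ n, {x | 0 < runMax T (fun x => φ x - c) n x} := by
      intro x hx
      simp only [Set.mem_ofPred_eq, not_exists, not_forall, not_le] at hx
      obtain ⟨n, hn⟩ := hx c
      refine Set.mem_iUnion.2 ⟨n, ?_⟩
      have := runMax_sum T (fun x => φ x - c) n x
      simp only [Finset.sum_sub_distrib, Finset.sum_const, Finset.card_range, nsmul_eq_mul] at this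
      rw [Set.mem_ofPred_eq]
      linarith
    refine (measure_mono hsub).trans ?_
    have hmono : Monotone fun n => {x | 0 < runMax T (fun x => φ x - c) n x} := by
      refine monotone_nat_of_le_succ fun n x hx => ?_
      exact lt_of_lt_of_le hx (runMax_succ T _ n x)
    rw [hmono.measure_iUnion]
    refine iSup_le fun n => ?_
    have := maximal_ineq μ T hT φ hφm hφ h0 c n
    rw [← ENNReal.ofReal_toReal (measure_ne_top μ {x | 0 < runMax T (fun x => φ x - c) n x})]
    apply ENNReal.ofReal_le_ofReal
    rw [le_div_iff₀ hc, mul_comm]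
    exact this
  rw [ae_iff]
  have hlim : Tendsto (fun n : ℕ => ENNReal.ofReal (I / ((n : ℝ) + 1))) atTop (nhds 0) := by
    rw [← ENNReal.ofReal_zero]
    apply ENNReal.tendsto_ofReal
    have := (tendsto_one_div_add_atTop_nhds_zero_nat (𝕜 := ℝ)).const_mul I
    simpa [div_eq_mul_inv] using this
  refine le_antisymm (ge_of_tendsto' hlim fun n => step _ (by positivity)) zero_le

theorem ae_sublinear {α : Type*} [MeasurableSpace α] (μ : Measure α) [IsProbabilityMeasure μ]
    (T : α → α) (hT : MeasurePreserving T μ μ) (φ : α → ℝ) (hφm : Measurable φ)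
    (hφ : Integrable φ μ) (h0 : ∀ x, 0 ≤ φ x) (ε : ℝ) (hε : 0 < ε) :
    ∀ᵐ x ∂μ, ∀ᶠ k : ℕ in atTop, φ (T^[k] x) ≤ ε * k := by
  let _ : MeasureSpace α := ⟨μ⟩
  have _ : IsProbabilityMeasure (volume : Measure α) := ‹IsProbabilityMeasure μ›
  have h1 := tsum_prob_mem_Ioi_lt_top (Ω := α) (X := fun x => φ x / ε) (hφ.div_const ε)
    (fun x => div_nonneg (h0 x) hε.le)
  have h2 : ∑' k : ℕ, μ {x | ε * k < φ (T^[k] x)} ≠ ∞ := by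
    refine ne_of_eq_of_ne ?_ h1.ne
    refine tsum_congr fun k => ?_
    have hs : MeasurableSet {x | ε * k < φ x} := measurableSet_lt measurable_const hφm
    have := (hT.iterate k).measure_preimage hs.nullMeasurableSet
    refine Eq.trans (b := μ (T^[k] ⁻¹' {x | ε * k < φ x})) rfl (this.trans ?_)
    show μ _ = μ _
    congr 1
    ext x
    simp only [Set.mem_ofPred_eq, Set.mem_Ioi]
    rw [lt_div_iff₀ hε, mul_comm]
  filter_upwards [ae_eventually_notMem h2] with x hx
  filter_upwards [hx] with k hk
  exact not_lt.1 hk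

theorem det_bound (l b : ℕ → ℝ) (hl : ∀ i, 0 ≤ l i) (hb : ∀ i, 0 ≤ b i) (v : ℝ) (hv : 0 ≤ v)
    (hC : ∃ C : ℝ, ∀ n : ℕ, ∑ i ∈ Finset.range n, Real.log (max (l i) 1) ≤ C * n)
    (hlim : atTop.limsup (fun n : ℕ => (∏ i ∈ Finset.range n, l i) ^ ((n : ℝ)⁻¹)) < 1)
    (hbk : ∀ j : ℕ, ∀ᶠ k : ℕ in atTop, Real.log (max (b k) 1) ≤ (1 / ((j : ℝ) + 1)) * k) :
    ∃ c : ℝ, ∀ n : ℕ, v * ∏ i ∈ Finset.range n, l i +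
      ∑ k ∈ Finset.range n, b k * ∏ i ∈ Finset.range k, l i ≤ c := by
  obtain ⟨C, hC⟩ := hC
  have hprod0 : ∀ n, 0 ≤ ∏ i ∈ Finset.range n, l i := fun n => Finset.prod_nonneg fun i _ => hl i
  have hbdd : IsBoundedUnder (· ≤ ·) atTop
      (fun n : ℕ => (∏ i ∈ Finset.range n, l i) ^ ((n : ℝ)⁻¹)) := by
    refine ⟨Real.exp C, eventually_map.2 ?_⟩
    filter_upwards [eventually_gt_atTop 0] with n hn
    have hn' : (0 : ℝ) < n := by exact_mod_cast hn
    rw [Real.rpow_inv_le_iff_of_pos (hprod0 n) (Real.exp_pos _).le hn', ← Real.exp_mul]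
    calc ∏ i ∈ Finset.range n, l i ≤ ∏ i ∈ Finset.range n, Real.exp (Real.log (max (l i) 1)) := by
          refine Finset.prod_le_prod (fun i _ => hl i) fun i _ => ?_
          rw [Real.exp_log (by positivity)]
          exact le_max_left _ _
      _ = Real.exp (∑ i ∈ Finset.range n, Real.log (max (l i) 1)) := (Real.exp_sum _ _).symm
      _ ≤ _ := Real.exp_le_exp.2 (hC n)
  obtain ⟨r, hr1, hr2⟩ := exists_between (max_lt hlim zero_lt_one)
  have hr0 : 0 < r := (le_max_right _ _).trans_lt hr1
  have hev := eventually_lt_of_limsup_lt ((le_max_left _ _).trans_lt hr1) hbdd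
  have hlogr : 0 < -Real.log r := by linarith [Real.log_neg hr0 hr2]
  obtain ⟨j, hj⟩ := exists_nat_one_div_lt (half_pos hlogr)
  -- terms are eventually dominated by geometric
  set q := Real.exp (Real.log r / 2) with hq
  have hq1 : q < 1 := by rw [hq, Real.exp_lt_one_iff]; linarith
  have hq0 : 0 < q := Real.exp_pos _
  have hprodev : ∀ᶠ n : ℕ in atTop, ∏ i ∈ Finset.range n, l i ≤ r ^ n := by
    filter_upwards [hev, eventually_gt_atTop 0] with n hn hn0
    have hn' : (0 : ℝ) < n := by exact_mod_cast hn0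
    have := (Real.rpow_inv_le_iff_of_pos (hprod0 n) hr0.le hn').1 hn.le
    rwa [Real.rpow_natCast] at this
  have hterm : ∀ᶠ n : ℕ in atTop, b n * ∏ i ∈ Finset.range n, l i ≤ q ^ n := by
    filter_upwards [hprodev, hbk j] with n hn hbn
    have hb1 : b n ≤ Real.exp (-Real.log r / 2 * n) := by
      calc b n ≤ max (b n) 1 := le_max_left _ _
        _ = Real.exp (Real.log (max (b n) 1)) := (Real.exp_log (by positivity)).symm
        _ ≤ _ := Real.exp_le_exp.2 (hbn.trans (by gcongr))
    calc b n * ∏ i ∈ Finset.range n, l i ≤ Real.exp (-Real.log r / 2 * n) * r ^ n := by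
          gcongr
          exact hprod0 n
      _ = q ^ n := by
          rw [hq, ← Real.exp_nat_mul]
          conv_lhs => rw [← Real.exp_log hr0]
          rw [← Real.exp_nat_mul, ← Real.exp_add, Real.log_exp]
          congr 1; ring
  have hsum : Summable fun n : ℕ => b n * ∏ i ∈ Finset.range n, l i := by
    refine Summable.of_norm_bounded_eventually_nat (summable_geometric_of_lt_one hq0.le hq1) ?_
    filter_upwards [hterm] with n hn
    rwa [Real.norm_of_nonneg (mul_nonneg (hb n) (hprod0 n))]
  have hbd1 : ∃ c1 : ℝ, ∀ n : ℕ, ∏ i ∈ Finset.range n, l i ≤ c1 := by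
    have : Tendsto (fun n : ℕ => ∏ i ∈ Finset.range n, l i) atTop (nhds 0) :=
      tendsto_of_tendsto_of_tendsto_of_le_of_le' tendsto_const_nhds
        (tendsto_pow_atTop_nhds_zero_of_lt_one hr0.le hr2)
        (Eventually.of_forall hprod0) hprodev
    obtain ⟨c1, hc1⟩ := this.bddAbove_range
    exact ⟨c1, fun n => hc1 ⟨n, rfl⟩⟩
  obtain ⟨c1, hc1⟩ := hbd1
  refine ⟨v * c1 + ∑' n : ℕ, b n * ∏ i ∈ Finset.range n, l i, fun n => ?_⟩
  gcongr
  · exact hc1 n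
  · exact hsum.sum_le_tsum _ fun i _ => mul_nonneg (hb i) (hprod0 i)



theorem exists_iSup_measure {α : Type*} [MeasurableSpace α] (m : ℕ → Measure α)
    (hm : Monotone m) : ∃ Λ : Measure α, ∀ A, MeasurableSet A → Λ A = ⨆ n, m n A := by
  refine ⟨Measure.ofMeasurable (fun A _ => ⨆ n, m n A) (by simp) ?_, fun A hA => ?_⟩
  · intro f hf hd
    simp_rw [fun n => measure_iUnion (μ := m n) hd hf]
    have := lintegral_iSup (μ := Measure.count) (f := fun n (i : ℕ) => m n (f i))
      (fun n => measurable_of_countable _) (fun a b hab i => hm hab (f i))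
    simp only [lintegral_count] at this
    exact this.symm
  · rw [Measure.ofMeasurable_apply _ hA]

/-- the skew product kernel -/
def skewK {X E : Type*} [MeasurableSpace X] [MeasurableSpace E] (θ : X ≃ᵐ X)
    (P : Kernel (X × E) E) : Kernel (X × E) (X × E) :=
  Kernel.deterministic (fun p : X × E => θ p.1) (θ.measurable.comp measurable_fst) ×ₖ P

instance {X E : Type*} [MeasurableSpace X] [MeasurableSpace E] (θ : X ≃ᵐ X)
    (P : Kernel (X × E) E) [IsMarkovKernel P] : IsMarkovKernel (skewK θ P) := by
  unfold skewK; infer_instance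

theorem lintegral_skewK {X E : Type*} [MeasurableSpace X] [MeasurableSpace E] (θ : X ≃ᵐ X)
    (P : Kernel (X × E) E) [IsMarkovKernel P] (f : X × E → ℝ≥0∞) (hf : Measurable f) (p : X × E) :
    ∫⁻ q, f q ∂(skewK θ P p) = ∫⁻ y, f (θ p.1, y) ∂(P p) := by
  rw [skewK, Kernel.lintegral_prod _ _ _ hf, Kernel.lintegral_deterministic']
  exact hf.lintegral_prod_right'

theorem skewK_apply {X E : Type*} [MeasurableSpace X] [MeasurableSpace E] (θ : X ≃ᵐ X)
    (P : Kernel (X × E) E) [IsMarkovKernel P] (A : Set (X × E)) (hA : MeasurableSet A) (p : X × E) :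
    skewK θ P p A = P p {y | (θ p.1, y) ∈ A} := by
  rw [← lintegral_indicator_one hA, lintegral_skewK _ _ _ (measurable_one.indicator hA)]
  change _ = P p (Prod.mk (θ p.1) ⁻¹' A)
  rw [← lintegral_indicator_one (measurable_prodMk_left hA)]
  rfl

theorem lintegral_comp' {α β : Type*} [MeasurableSpace α] [MeasurableSpace β] (κ : Kernel α β)
    (μ : Measure α) (f : β → ℝ≥0∞) (hf : Measurable f) :
    ∫⁻ b, f b ∂(κ ∘ₘ μ) = ∫⁻ a, ∫⁻ b, f b ∂(κ a) ∂μ :=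
  Measure.lintegral_bind κ.aemeasurable hf.aemeasurable

theorem comp_mono' {α β : Type*} [MeasurableSpace α] [MeasurableSpace β] (κ : Kernel α β)
    {μ ν : Measure α} (h : μ ≤ ν) : κ ∘ₘ μ ≤ κ ∘ₘ ν := by
  refine Measure.le_iff.2 fun A hA => ?_
  rw [Measure.bind_apply hA κ.aemeasurable, Measure.bind_apply hA κ.aemeasurable]
  exact lintegral_mono' h le_rfl

theorem comp_univ' {α β : Type*} [MeasurableSpace α] [MeasurableSpace β] (κ : Kernel α β)
    [IsMarkovKernel κ] (μ : Measure α) : (κ ∘ₘ μ) Set.univ = μ Set.univ := by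
  rw [Measure.bind_apply .univ κ.aemeasurable]; simp

/-- a finite subinvariant measure is invariant -/
theorem eq_of_le_mass {α : Type*} [MeasurableSpace α] {μ ν : Measure α} [IsFiniteMeasure ν]
    (h : μ ≤ ν) (hm : μ Set.univ = ν Set.univ) : μ = ν := by
  have : IsFiniteMeasure μ := ⟨hm ▸ measure_lt_top ν _⟩
  ext A hA
  refine le_antisymm (h A) ?_
  have h1 := measure_add_measure_compl (μ := μ) hA
  have h2 := measure_add_measure_compl (μ := ν) hA
  have h3 : ν A + μ Aᶜ ≤ μ A + μ Aᶜ := by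
    rw [h1, hm, ← h2]; gcongr
  exact (ENNReal.add_le_add_iff_right (measure_ne_top μ _)).1 h3

/-- liminf of the orbit is invariant -/
theorem exists_liminf_invariant {S : Type*} [MeasurableSpace S] (K : Kernel S S) [IsMarkovKernel K]
    (p : ℕ → Measure S) (hp : ∀ n, IsProbabilityMeasure (p n)) (hpK : ∀ n, p (n + 1) = K ∘ₘ (p n)) :
    ∃ Λ : Measure S, IsFiniteMeasure Λ ∧ K ∘ₘ Λ = Λ ∧
      (∀ γ : Measure S, (∃ N, ∀ n ≥ N, γ ≤ p n) → γ ≤ Λ) ∧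
      (∀ A, MeasurableSet A → ∀ c : ℝ≥0∞, (∀ n, p n A ≤ c) → Λ A ≤ c) := by
  set m : ℕ → Measure S := fun N => ⨅ n, p (N + n) with hmdef
  have hmle : ∀ N n, N ≤ n → m N ≤ p n := fun N n h => by
    have := iInf_le (fun k => p (N + k)) (n - N)
    rwa [Nat.add_sub_cancel' h] at this
  have hmono : Monotone m := fun a b hab => le_iInf fun n => hmle a _ (by omega)
  obtain ⟨Λ, hΛ⟩ := exists_iSup_measure m hmono
  have hmΛ : ∀ N, m N ≤ Λ := fun N => Measure.le_iff.2 fun A hA => by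
    rw [hΛ A hA]; exact le_iSup (fun n => m n A) N
  have hupper : ∀ A, MeasurableSet A → ∀ c : ℝ≥0∞, (∀ n, p n A ≤ c) → Λ A ≤ c := by
    intro A hA c hc
    rw [hΛ A hA]
    exact iSup_le fun n => (hmle n n le_rfl A).trans (hc n)
  have hfin : IsFiniteMeasure Λ := ⟨(hupper _ .univ 1 (fun n => prob_le_one)).trans_lt
    ENNReal.one_lt_top⟩
  have hmfin : ∀ N, IsFiniteMeasure (m N) := fun N => isFiniteMeasure_of_le Λ (hmΛ N)
  have hstep : ∀ N, K ∘ₘ (m N) ≤ Λ := fun N => by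
    refine le_trans ?_ (hmΛ (N + 1))
    refine le_iInf fun n => ?_
    have : N + 1 + n = (N + n) + 1 := by omega
    rw [this, hpK]
    exact comp_mono' K (hmle N _ (by omega))
  have hsub : K ∘ₘ Λ ≤ Λ := by
    refine Measure.le_iff.2 fun A hA => ?_
    have hb : ∀ N, (K ∘ₘ Λ) A ≤ Λ A + (Λ Set.univ - m N Set.univ) := by
      intro N
      have hdec : Λ = m N + (Λ - m N) := by
        rw [add_comm, Measure.sub_add_cancel_of_le (hmΛ N)]
      calc (K ∘ₘ Λ) A = ∫⁻ s, K s A ∂Λ := Measure.bind_apply hA K.aemeasurable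
        _ = ∫⁻ s, K s A ∂(m N) + ∫⁻ s, K s A ∂(Λ - m N) := by
            conv_lhs => rw [hdec]
            rw [lintegral_add_measure]
        _ ≤ Λ A + (Λ Set.univ - m N Set.univ) := by
            gcongr
            · rw [← Measure.bind_apply hA K.aemeasurable]; exact hstep N A
            · rw [← Measure.sub_apply .univ (hmΛ N)]
              calc ∫⁻ s, K s A ∂(Λ - m N) ≤ ∫⁻ s, 1 ∂(Λ - m N) :=
                    lintegral_mono fun s => prob_le_one
                _ = _ := by simp
    have hlim : Tendsto (fun N => Λ A + (Λ Set.univ - m N Set.univ)) atTop (nhds (Λ A + 0)) := by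
      refine Tendsto.const_add _ ?_
      have h1 : Tendsto (fun N => m N Set.univ) atTop (nhds (Λ Set.univ)) := by
        rw [hΛ _ .univ]; exact tendsto_atTop_iSup fun a b hab => hmono hab _
      have := ENNReal.Tendsto.sub (tendsto_const_nhds (x := Λ Set.univ)) h1
        (Or.inl (measure_ne_top Λ _))
      simpa using this
    have := ge_of_tendsto' hlim hb
    simpa using this
  refine ⟨Λ, hfin, eq_of_le_mass hsub (comp_univ' K Λ), ?_, hupper⟩
  rintro γ ⟨N, hN⟩
  exact (le_iInf fun n => hN (N + n) (by omega)).trans (hmΛ N)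


theorem exists_invariant {X E : Type*} [MeasurableSpace X] [MeasurableSpace E] (θ : X ≃ᵐ X)
    (Q : Measure X) [IsProbabilityMeasure Q] (hQ : MeasurePreserving θ Q Q)
    (P : Kernel (X × E) E) [IsMarkovKernel P] (V : E → ℝ≥0∞) (hV : Measurable V)
    (l b : X → ℝ≥0∞) (hl : Measurable l) (hb : Measurable b)
    (hdrift : ∀ x y, ∫⁻ z, V z ∂(P (x, y)) ≤ l x * V y + b x) (y0 : E)
    (U : ℕ → X → ℝ≥0∞) (hU : ∀ n, Measurable (U n)) (hU0 : ∀ x, U 0 x = V y0)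
    (hUs : ∀ n x, U (n + 1) (θ x) = l x * U n x + b x)
    (hUb : ∀ᵐ x ∂Q, ∃ c : ℕ, ∀ n, U n x ≤ c)
    (hsmall : ∀ R : ℕ, ∃ ν : Kernel X E, IsMarkovKernel ν ∧ ∃ e : X → ℝ≥0∞, Measurable e ∧
      (∀ x, e x ≠ 0) ∧ (∀ x, e x ≤ 1) ∧
      ∀ x y A, MeasurableSet A → V y ≤ R → e x * ν x A ≤ P (x, y) A) :
    ∃ Pi0 : Measure (X × E), IsProbabilityMeasure Pi0 ∧ Pi0.map Prod.fst = Q ∧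
      (skewK θ P) ∘ₘ Pi0 = Pi0 := by
  set K := skewK θ P with hK
  set p : ℕ → Measure (X × E) := fun n =>
    Nat.rec (Q.map (fun x => (x, y0))) (fun _ q => K ∘ₘ q) n with hpdef
  have hp0 : p 0 = Q.map (fun x => (x, y0)) := rfl
  have hps : ∀ n, p (n + 1) = K ∘ₘ p n := fun n => rfl
  have hmeas0 : Measurable (fun x : X => (x, y0)) := by fun_prop
  have hθm : Measurable θ := θ.measurable
  have hp : ∀ n, IsProbabilityMeasure (p n) := by
    intro n
    induction n with
    | zero => rw [hp0]; exact Measure.isProbabilityMeasure_map hmeas0.aemeasurable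
    | succ n ih => rw [hps]; infer_instance
  have hmarg : ∀ n (g : X → ℝ≥0∞), Measurable g → ∫⁻ q, g q.1 ∂(p n) = ∫⁻ x, g x ∂Q := by
    intro n
    induction n with
    | zero => 
      intro g hg
      rw [hp0, lintegral_map (by fun_prop) hmeas0]
    | succ n ih =>
      intro g hg
      rw [hps, lintegral_comp' _ _ _ (by fun_prop)]
      simp_rw [hK, lintegral_skewK θ P (fun q => g q.1) (by fun_prop)]
      simp only [lintegral_const, measure_univ, mul_one]
      rw [ih (fun x => g (θ x)) (by fun_prop), ← hQ.lintegral_comp hg]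
  have hdr : ∀ n (g : X → ℝ≥0∞), Measurable g →
      ∫⁻ q, g q.1 * V q.2 ∂(p n) ≤ ∫⁻ x, g x * U n x ∂Q := by
    intro n
    induction n with
    | zero => 
      intro g hg
      rw [hp0, lintegral_map (by fun_prop) hmeas0]
      simp [hU0]
    | succ n ih =>
      intro g hg
      rw [hps, lintegral_comp' _ _ _ (by fun_prop)]
      simp_rw [hK, lintegral_skewK θ P (fun q => g q.1 * V q.2) (by fun_prop)]
      calc ∫⁻ q, ∫⁻ y, g (θ q.1) * V y ∂(P q) ∂(p n)
          ≤ ∫⁻ q, (g (θ q.1) * l q.1) * V q.2 + g (θ q.1) * b q.1 ∂(p n) := by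
            refine lintegral_mono fun q => ?_
            rw [lintegral_const_mul _ hV]
            calc _ ≤ g (θ q.1) * (l q.1 * V q.2 + b q.1) := by gcongr; exact hdrift q.1 q.2
              _ = _ := by ring
        _ = ∫⁻ q, (g (θ q.1) * l q.1) * V q.2 ∂(p n) + ∫⁻ q, g (θ q.1) * b q.1 ∂(p n) := by
            rw [lintegral_add_left (by fun_prop)]
        _ ≤ ∫⁻ x, (g (θ x) * l x) * U n x ∂Q + ∫⁻ x, g (θ x) * b x ∂Q := by
            refine add_le_add (ih (fun x => g (θ x) * l x) (by fun_prop)) ?_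
            exact (hmarg n (fun x => g (θ x) * b x) (by fun_prop)).le
        _ = ∫⁻ x, g (θ x) * U (n + 1) (θ x) ∂Q := by
            rw [← lintegral_add_left (by fun_prop)]
            refine lintegral_congr fun x => ?_
            rw [hUs]; ring
        _ = ∫⁻ x, g x * U (n + 1) x ∂Q :=
            hQ.lintegral_comp (f := fun x => g x * U (n + 1) x) (by fun_prop)
  -- good sets
  set G : ℕ → Set X := fun c => {x | ∀ n, U n x ≤ c} with hG
  have hGm : ∀ c, MeasurableSet (G c) := fun c => by
    have : G c = ⋂ n, {x | U n x ≤ c} := by ext x; simp [hG]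
    rw [this]
    exact MeasurableSet.iInter fun n => measurableSet_le (hU n) measurable_const
  have hhalf : ∀ (c n : ℕ) (Ψ : X → ℝ≥0∞), Measurable Ψ → (∀ x, Ψ x ≤ 1) →
      (∫⁻ x in G c, Ψ x ∂Q) / 2 ≤ 
        ∫⁻ q, ({q : X × E | V q.2 ≤ (2 * (c + 1) : ℕ)}).indicator (fun q => Ψ q.1) q ∂(p n) := by
    intro c n Ψ hΨ hΨ1
    set R : ℝ≥0∞ := ((2 * (c + 1) : ℕ) : ℝ≥0∞) with hR
    set g : X → ℝ≥0∞ := (G c).indicator Ψ with hg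
    have hgm : Measurable g := hΨ.indicator (hGm c)
    have hs : MeasurableSet {q : X × E | V q.2 ≤ R} :=
      measurableSet_le (by fun_prop) measurable_const
    have hI : ∫⁻ x in G c, Ψ x ∂Q = ∫⁻ x, g x ∂Q := (lintegral_indicator (hGm c) _).symm
    rw [hI]
    have hIfin : ∫⁻ x, g x ∂Q ≠ ∞ := by
      refine ne_top_of_le_ne_top (b := 1) ENNReal.one_ne_top ?_
      calc ∫⁻ x, g x ∂Q ≤ ∫⁻ x, 1 ∂Q := by
            refine lintegral_mono fun x => ?_
            exact (Set.indicator_le_self' (fun _ _ => zero_le) x).trans (hΨ1 x)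
        _ = 1 := by simp
    have hR0 : R ≠ 0 := by rw [hR]; simp
    have hRt : R ≠ ∞ := ENNReal.natCast_ne_top _
    have hsplit : ∀ q : X × E, g q.1 ≤ 
        ({q : X × E | V q.2 ≤ R}).indicator (fun q => Ψ q.1) q + R⁻¹ * (g q.1 * V q.2) := by
      intro q
      by_cases hq : V q.2 ≤ R
      · rw [Set.indicator_of_mem (by exact hq)]
        exact le_add_right (Set.indicator_le_self' (fun _ _ => zero_le) _)
      · rw [Set.indicator_of_notMem (by exact hq), zero_add]
        have hq' : R ≤ V q.2 := (not_le.1 hq).le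
        calc g q.1 = R⁻¹ * (g q.1 * R) := by
              rw [mul_comm (g q.1), ← mul_assoc, ENNReal.inv_mul_cancel hR0 hRt, one_mul]
          _ ≤ _ := by gcongr
    have h1 : ∫⁻ q, R⁻¹ * (g q.1 * V q.2) ∂(p n) ≤ (∫⁻ x, g x ∂Q) / 2 := by
      rw [lintegral_const_mul _ (by fun_prop)]
      calc R⁻¹ * ∫⁻ q, g q.1 * V q.2 ∂(p n) ≤ R⁻¹ * ∫⁻ x, g x * U n x ∂Q := by
            gcongr; exact hdr n g hgm
        _ ≤ R⁻¹ * ∫⁻ x, g x * (c + 1) ∂Q := by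
            refine mul_le_mul' le_rfl (lintegral_mono fun x => ?_)
            by_cases hx : x ∈ G c
            · exact mul_le_mul' le_rfl ((hx n).trans le_self_add)
            · simp [hg, hx]
        _ = (∫⁻ x, g x ∂Q) * ((c + 1) * R⁻¹) := by
            rw [lintegral_mul_const _ hgm]; ring
        _ = _ := by
            rw [div_eq_mul_inv]
            congr 1
            rw [hR]
            push_cast
            rw [ENNReal.mul_inv (by simp) (by simp), mul_comm, mul_assoc,
              ENNReal.inv_mul_cancel (by simp) (by simp), mul_one]
    have h2 : ∫⁻ x, g x ∂Q ≤ 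
        ∫⁻ q, ({q : X × E | V q.2 ≤ R}).indicator (fun q => Ψ q.1) q ∂(p n) + (∫⁻ x, g x ∂Q) / 2 := by
      calc ∫⁻ x, g x ∂Q = ∫⁻ q, g q.1 ∂(p n) := (hmarg n g hgm).symm
        _ ≤ _ := lintegral_mono hsplit
        _ = _ := lintegral_add_right _ (by fun_prop)
        _ ≤ _ := by gcongr
    rw [← ENNReal.add_halves (∫⁻ x, g x ∂Q)] at h2
    rw [ENNReal.add_halves] at h2
    conv_lhs at h2 => rw [← ENNReal.add_halves (∫⁻ x, g x ∂Q)]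
    exact (ENNReal.add_le_add_iff_right (ENNReal.div_ne_top hIfin (by simp))).1 h2
  obtain ⟨Λ, hΛfin, hΛK, hΛlow, hΛup⟩ := exists_liminf_invariant K p hp hps
  -- the marginal
  set L := Λ.map Prod.fst with hL
  have hLle : L ≤ Q := by
    refine Measure.le_iff.2 fun B hB => ?_
    rw [hL, Measure.map_apply measurable_fst hB]
    refine hΛup _ (measurable_fst hB) _ fun n => ?_
    have := hmarg n (B.indicator 1) (measurable_one.indicator hB)
    rw [lintegral_indicator_one hB] at this
    rw [← this, ← lintegral_indicator_one (measurable_fst hB)]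
    rfl
  have hLfin : IsFiniteMeasure L := isFiniteMeasure_of_le Q hLle
  have hLac : L ≪ Q := Measure.absolutelyContinuous_of_le hLle
  have hLint : ∀ g : X → ℝ≥0∞, Measurable g → ∫⁻ x, g (θ x) ∂L = ∫⁻ x, g x ∂L := by
    intro g hg
    rw [hL, lintegral_map hg measurable_fst, lintegral_map (by fun_prop) measurable_fst]
    conv_rhs => rw [← hΛK, lintegral_comp' _ _ _ (by fun_prop)]
    simp_rw [hK, lintegral_skewK θ P (fun q => g q.1) (by fun_prop)]
    simp
  set h := L.rnDeriv Q with hh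
  have hhm : Measurable h := Measure.measurable_rnDeriv L Q
  have hwd : Q.withDensity h = L := Measure.withDensity_rnDeriv_eq L Q hLac
  have hhtop : ∀ᵐ x ∂Q, h x < ∞ := Measure.rnDeriv_lt_top L Q
  have hLQ : ∀ g : X → ℝ≥0∞, Measurable g → ∫⁻ x, g x ∂L = ∫⁻ x, h x * g x ∂Q := by
    intro g hg
    rw [← hwd, lintegral_withDensity_eq_lintegral_mul _ hhm hg]
    rfl
  have hinv : ∀ᵐ x ∂Q, h (θ x) = h x := by
    refine ae_eq_of_forall_setLIntegral_eq_of_sigmaFinite (by fun_prop) hhm fun B hB _ => ?_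
    have hB' : MeasurableSet (θ.symm ⁻¹' B) := θ.symm.measurable hB
    have e1 := hQ.lintegral_comp (f := fun x => h x * (θ.symm ⁻¹' B).indicator 1 x)
      (hhm.mul (measurable_one.indicator hB'))
    rw [← hLQ _ (measurable_one.indicator hB'), ← hLint _ (measurable_one.indicator hB'),
      hLQ (fun x => (θ.symm ⁻¹' B).indicator 1 (θ x)) ((measurable_one.indicator hB').comp hθm)] at e1
    have hind : ∀ x, (θ.symm ⁻¹' B).indicator (1 : X → ℝ≥0∞) (θ x) = B.indicator 1 x := by
      intro x
      by_cases hx : x ∈ B <;> simp [Set.indicator, hx]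
    simp only [hind] at e1
    rw [← lintegral_indicator hB, ← lintegral_indicator hB]
    refine Eq.trans (lintegral_congr fun x => ?_) (e1.trans (lintegral_congr fun x => ?_))
    · by_cases hx : x ∈ B <;> simp [hx]
    · by_cases hx : x ∈ B <;> simp [hx]
  have hpos : ∀ᵐ x ∂Q, h x ≠ 0 := by
    set N := {x | h x = 0} with hN
    have hNm : MeasurableSet N := hhm (measurableSet_singleton 0)
    have hLN : L N = 0 := by
      rw [← hwd, withDensity_apply _ hNm]
      rw [setLIntegral_congr_fun hNm (g := fun _ => 0) (fun x hx => hx)]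
      simp
    have hGN : ∀ c, Q (G c ∩ θ ⁻¹' N) = 0 := by
      intro c
      obtain ⟨ν, hν, e, hem, he0, he1, hmin⟩ := hsmall (2 * (c + 1))
      set Nk : Kernel X (X × E) := Kernel.deterministic θ hθm ×ₖ ν with hNk
      have hNkapp : ∀ x A, MeasurableSet A → Nk x A = ν x {y | (θ x, y) ∈ A} := by
        intro x A hA
        rw [hNk, Kernel.prod_apply, Kernel.deterministic_apply, Measure.dirac_prod,
          Measure.map_apply (by fun_prop) hA]
        rfl
      set γ : Measure (X × E) := Nk ∘ₘ ((Q.restrict (G c)).withDensity (fun x => e x / 2)) with hγ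
      have hγapp : ∀ A, MeasurableSet A → γ A = (∫⁻ x in G c, e x * Nk x A ∂Q) / 2 := by
        intro A hA
        have hNm' : Measurable fun x => Nk x A := Nk.measurable_coe hA
        rw [hγ, Measure.bind_apply hA Nk.aemeasurable,
          lintegral_withDensity_eq_lintegral_mul _ (by fun_prop) hNm', div_eq_mul_inv,
          ← lintegral_mul_const _ (by fun_prop)]
        refine lintegral_congr fun x => ?_
        simp only [Pi.mul_apply, div_eq_mul_inv]
        ring
      have hγle : γ ≤ Λ := by
        refine hΛlow γ ⟨1, fun n hn => ?_⟩
        obtain ⟨k, rfl⟩ : ∃ k, n = k + 1 := ⟨n - 1, by omega⟩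
        refine Measure.le_iff.2 fun A hA => ?_
        have hNm' : Measurable fun x => Nk x A := Nk.measurable_coe hA
        rw [hγapp A hA, hps, Measure.bind_apply hA K.aemeasurable]
        refine (hhalf c k (fun x => e x * Nk x A) (by fun_prop) fun x => ?_).trans ?_
        · exact mul_le_one' (he1 x) prob_le_one
        · refine lintegral_mono fun q => ?_
          by_cases hq : V q.2 ≤ (2 * (c + 1) : ℕ)
          · rw [Set.indicator_of_mem (by exact hq), hK, skewK_apply θ P A hA, hNkapp _ _ hA]
            exact hmin q.1 q.2 _ (measurable_prodMk_left hA) hq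
          · rw [Set.indicator_of_notMem (by exact hq)]
            exact zero_le
      have hz : γ (Prod.fst ⁻¹' N) = 0 := by
        refine le_antisymm ((hγle _).trans ?_) zero_le
        rw [← Measure.map_apply measurable_fst hNm, ← hL, hLN]
      rw [hγapp _ (measurable_fst hNm), ENNReal.div_eq_zero_iff] at hz
      replace hz := hz.resolve_right (by simp)
      rw [lintegral_eq_zero_iff (f := fun x => e x * Nk x (Prod.fst ⁻¹' N))
        (hem.mul (Nk.measurable_coe (measurable_fst hNm)))] at hz
      rw [EventuallyEq, ae_restrict_iff' (hGm c)] at hz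
      have : ∀ᵐ x ∂Q, x ∉ G c ∩ θ ⁻¹' N := by
        filter_upwards [hz] with x hx hxm
        have := hx hxm.1
        simp only [Pi.zero_apply, mul_eq_zero, he0 x, false_or] at this
        rw [hNkapp _ _ (measurable_fst hNm)] at this
        have h3 : {y : E | (θ x, y) ∈ Prod.fst ⁻¹' N} = Set.univ := by
          ext y; simpa using hxm.2
        rw [h3] at this
        simp at this
      exact measure_eq_zero_iff_ae_notMem.2 this
    have hθN : Q (θ ⁻¹' N) = 0 := by
      have : θ ⁻¹' N ⊆ (⋃ c, (G c ∩ θ ⁻¹' N)) ∪ {x | ¬ ∃ c : ℕ, ∀ n, U n x ≤ c} := by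
        intro x hx
        by_cases hc : ∃ c : ℕ, ∀ n, U n x ≤ c
        · obtain ⟨c, hc⟩ := hc
          exact Or.inl (Set.mem_iUnion.2 ⟨c, hc, hx⟩)
        · exact Or.inr hc
      refine measure_mono_null this (measure_union_null (measure_iUnion_null hGN) ?_)
      exact ae_iff.1 hUb
    rw [hQ.measure_preimage hNm.nullMeasurableSet] at hθN
    exact measure_eq_zero_iff_ae_notMem.1 hθN
  have hwm : Measurable fun q : X × E => (h q.1)⁻¹ := by fun_prop
  set Pi0 := Λ.withDensity (fun q => (h q.1)⁻¹) with hPi0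
  have hPi0marg : Pi0.map Prod.fst = Q := by
    ext B hB
    rw [Measure.map_apply measurable_fst hB, hPi0, withDensity_apply _ (measurable_fst hB),
      ← lintegral_indicator (measurable_fst hB)]
    calc _ = ∫⁻ q, (B.indicator (fun x => (h x)⁻¹)) q.1 ∂Λ := rfl
      _ = ∫⁻ x, B.indicator (fun x => (h x)⁻¹) x ∂L := by
          rw [hL]
          exact (lintegral_map (f := B.indicator (fun x => (h x)⁻¹)) (hhm.inv.indicator hB)
            measurable_fst).symm
      _ = ∫⁻ x, h x * B.indicator (fun x => (h x)⁻¹) x ∂Q := hLQ _ (hhm.inv.indicator hB)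
      _ = ∫⁻ x, B.indicator 1 x ∂Q := by
          refine lintegral_congr_ae ?_
          filter_upwards [hpos, hhtop] with x h1 h2
          by_cases hx : x ∈ B
          · simp [hx, ENNReal.mul_inv_cancel h1 h2.ne]
          · simp [hx]
      _ = Q B := lintegral_indicator_one hB
  refine ⟨Pi0, ⟨?_⟩, hPi0marg, ?_⟩
  · rw [← Set.preimage_univ (f := Prod.fst), ← Measure.map_apply measurable_fst .univ, hPi0marg]
    simp
  · ext A hA
    have hKA : Measurable fun q => K q A := K.measurable_coe hA
    rw [Measure.bind_apply hA K.aemeasurable, hPi0, 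
      lintegral_withDensity_eq_lintegral_mul _ hwm hKA, withDensity_apply _ hA,
      ← lintegral_indicator hA]
    conv_rhs => rw [← hΛK, lintegral_comp' _ _ _ (hwm.indicator hA)]
    have hae : ∀ᵐ q ∂Λ, h (θ q.1) = h q.1 :=
      ae_of_ae_map measurable_fst.aemeasurable (hLac.ae_le hinv)
    refine lintegral_congr_ae ?_
    filter_upwards [hae] with q hq
    simp only [Pi.mul_apply]
    rw [hK, lintegral_skewK θ P _ (hwm.indicator hA), skewK_apply θ P A hA]
    change _ = ∫⁻ y, (Prod.mk (θ q.1) ⁻¹' A).indicator (fun _ => (h (θ q.1))⁻¹) y ∂(P q)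
    rw [lintegral_indicator_const (measurable_prodMk_left hA), hq]
    rfl


theorem add_right_cancel_measure {α : Type*} [MeasurableSpace α] {μ ν m : Measure α}
    [IsFiniteMeasure m] (h : μ + m = ν + m) : μ = ν := by
  ext A _
  have := congrArg (fun k : Measure α => k A) h
  simp only [Measure.add_apply] at this
  exact (ENNReal.add_left_inj (measure_ne_top m A)).1 this

theorem singular_invariant_zero {X E : Type*} [MeasurableSpace X] [MeasurableSpace E] (θ : X ≃ᵐ X)
    (P : Kernel (X × E) E) [IsMarkovKernel P] (V : E → ℝ≥0∞) (hV : Measurable V)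
    (hVfin : ∀ y, V y ≠ ∞)
    (hsmall : ∀ R : ℕ, ∃ ν : Kernel X E, IsMarkovKernel ν ∧ ∃ e : X → ℝ≥0∞, Measurable e ∧
      (∀ x, e x ≠ 0) ∧ (∀ x, e x ≤ 1) ∧
      ∀ x y A, MeasurableSet A → V y ≤ R → e x * ν x A ≤ P (x, y) A)
    (α β : Measure (X × E)) [IsFiniteMeasure α] [IsFiniteMeasure β]
    (hα : (skewK θ P) ∘ₘ α = α) (hβ : (skewK θ P) ∘ₘ β = β)
    (hq : α.map Prod.fst = β.map Prod.fst) (s : Set (X × E)) (hs : MeasurableSet s)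
    (hαs : α s = 0) (hβs : β sᶜ = 0) : α = 0 := by
  set K := skewK θ P with hK
  have hsR : ∀ R : ℕ, MeasurableSet {q : X × E | V q.2 ≤ R} := fun R =>
    measurableSet_le (by fun_prop) measurable_const
  have huniv : α Set.univ = β Set.univ := by
    have := congrArg (fun k : Measure X => k Set.univ) hq
    simpa [Measure.map_apply measurable_fst .univ] using this
  have key : ∀ R : ℕ, α {q : X × E | V q.2 ≤ R} + β {q : X × E | V q.2 ≤ R} ≤ α Set.univ := by
    intro R
    obtain ⟨ν, hν, e, hem, he0, he1, hmin⟩ := hsmall R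
    set Nk : Kernel X (X × E) := Kernel.deterministic θ θ.measurable ×ₖ ν with hNk
    have hNkapp : ∀ x A, MeasurableSet A → Nk x A = ν x {y | (θ x, y) ∈ A} := by
      intro x A hA
      rw [hNk, Kernel.prod_apply, Kernel.deterministic_apply, Measure.dirac_prod,
        Measure.map_apply (by fun_prop) hA]
      rfl
    have hone : ∀ (γ : Measure (X × E)) (A : Set (X × E)), MeasurableSet A → K ∘ₘ γ = γ →
        γ A = 0 → γ {q : X × E | V q.2 ≤ R} ≤ (γ.map Prod.fst) {x | Nk x A = 0} := by
      intro γ A hA hγ h0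
      have hGm : MeasurableSet {x | Nk x A = 0} := Nk.measurable_coe hA (measurableSet_singleton 0)
      rw [Measure.map_apply measurable_fst hGm]
      have h1 : ∫⁻ q, K q A ∂γ = 0 := by
        rw [← Measure.bind_apply hA K.aemeasurable, hγ, h0]
      rw [lintegral_eq_zero_iff (K.measurable_coe hA)] at h1
      refine measure_mono_ae ?_
      filter_upwards [h1] with q hq hqR
      have h2 := hmin q.1 q.2 _ (measurable_prodMk_left (x := θ q.1) hA) hqR
      have h3 : K q A = 0 := hq
      rw [hK, skewK_apply θ P A hA] at h3
      have h4 : e q.1 * Nk q.1 A ≤ 0 := by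
        rw [hNkapp _ _ hA, ← h3]; exact h2
      have h5 := (mul_eq_zero.1 (le_antisymm h4 zero_le)).resolve_left (he0 _)
      exact h5
    have h1 := hone α s hs hα hαs
    have h2 := hone β sᶜ hs.compl hβ hβs
    rw [← hq] at h2
    have hG'm : MeasurableSet {x | Nk x sᶜ = 0} :=
      Nk.measurable_coe hs.compl (measurableSet_singleton 0)
    have hdis : Disjoint {x | Nk x s = 0} {x | Nk x sᶜ = 0} := by
      rw [Set.disjoint_left]
      intro x hx hx'
      have h3 : Nk x s = 0 := hx
      have h4 : Nk x sᶜ = 0 := hx'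
      have := measure_add_measure_compl (μ := Nk x) hs
      rw [h3, h4] at this
      simp at this
    calc _ ≤ (α.map Prod.fst) {x | Nk x s = 0} + (α.map Prod.fst) {x | Nk x sᶜ = 0} :=
          add_le_add h1 h2
      _ = (α.map Prod.fst) ({x | Nk x s = 0} ∪ {x | Nk x sᶜ = 0}) :=
          (measure_union hdis hG'm).symm
      _ ≤ (α.map Prod.fst) Set.univ := measure_mono (Set.subset_univ _)
      _ = α Set.univ := by rw [Measure.map_apply measurable_fst .univ, Set.preimage_univ]
  have hlim : ∀ γ : Measure (X × E),
      Tendsto (fun R : ℕ => γ {q : X × E | V q.2 ≤ R}) atTop (nhds (γ Set.univ)) := by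
    intro γ
    have hU : (⋃ R : ℕ, {q : X × E | V q.2 ≤ R}) = Set.univ := by
      refine Set.eq_univ_of_forall fun q => ?_
      obtain ⟨n, hn⟩ := ENNReal.exists_nat_gt (hVfin q.2)
      exact Set.mem_iUnion.2 ⟨n, by exact hn.le⟩
    rw [← hU]
    refine tendsto_measure_iUnion_atTop fun a b hab q hq => ?_
    have h1 : V q.2 ≤ a := hq
    exact h1.trans (by exact_mod_cast hab)
  have h := le_of_tendsto' ((hlim α).add (hlim β)) key
  rw [← huniv] at h
  have h0 : α Set.univ ≤ 0 := by
    have : α Set.univ + α Set.univ ≤ 0 + α Set.univ := by rwa [zero_add]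
    exact (ENNReal.add_le_add_iff_right (measure_ne_top α _)).1 this
  exact Measure.measure_univ_eq_zero.1 (le_antisymm h0 zero_le)

theorem invariant_unique {X E : Type*} [MeasurableSpace X] [MeasurableSpace E] (θ : X ≃ᵐ X)
    (P : Kernel (X × E) E) [IsMarkovKernel P] (V : E → ℝ≥0∞) (hV : Measurable V)
    (hVfin : ∀ y, V y ≠ ∞)
    (hsmall : ∀ R : ℕ, ∃ ν : Kernel X E, IsMarkovKernel ν ∧ ∃ e : X → ℝ≥0∞, Measurable e ∧
      (∀ x, e x ≠ 0) ∧ (∀ x, e x ≤ 1) ∧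
      ∀ x y A, MeasurableSet A → V y ≤ R → e x * ν x A ≤ P (x, y) A)
    (p1 p2 : Measure (X × E)) [IsFiniteMeasure p1] [IsFiniteMeasure p2]
    (h1 : (skewK θ P) ∘ₘ p1 = p1) (h2 : (skewK θ P) ∘ₘ p2 = p2)
    (hq : p1.map Prod.fst = p2.map Prod.fst) : p1 = p2 := by
  set K := skewK θ P with hK
  obtain ⟨s, hs⟩ := exists_isHahnDecomposition p1 p2
  have hsm := hs.measurableSet
  set m := p1.restrict s + p2.restrict sᶜ with hm
  have hm1 : m ≤ p1 := by
    conv_rhs => rw [← Measure.restrict_add_restrict_compl (μ := p1) hsm]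
    exact add_le_add le_rfl hs.ge_on_compl
  have hm2 : m ≤ p2 := by
    conv_rhs => rw [← Measure.restrict_add_restrict_compl (μ := p2) hsm]
    exact add_le_add hs.le_on le_rfl
  have hmf : IsFiniteMeasure m := isFiniteMeasure_of_le p1 hm1
  have hKm : K ∘ₘ m = m := by
    refine eq_of_le_mass ?_ (comp_univ' K m)
    have a1 : K ∘ₘ m ≤ p1 := (comp_mono' K hm1).trans h1.le
    have a2 : K ∘ₘ m ≤ p2 := (comp_mono' K hm2).trans h2.le
    conv_lhs => rw [← Measure.restrict_add_restrict_compl (μ := K ∘ₘ m) hsm]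
    exact add_le_add (Measure.restrict_mono le_rfl a1) (Measure.restrict_mono le_rfl a2)
  have hms1 : m s = p1 s := by simp [hm, hsm]
  have hms2 : m sᶜ = p2 sᶜ := by simp [hm, hsm]
  have e1 := Measure.sub_add_cancel_of_le hm1
  have e2 := Measure.sub_add_cancel_of_le hm2
  have hf1 : IsFiniteMeasure (p1 - m) := isFiniteMeasure_of_le p1 Measure.sub_le
  have hf2 : IsFiniteMeasure (p2 - m) := isFiniteMeasure_of_le p2 Measure.sub_le
  have i1 : K ∘ₘ (p1 - m) = p1 - m := by
    apply add_right_cancel_measure (m := m)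
    conv_lhs => rw [← hKm, ← Measure.comp_add, hKm, e1, h1]
    exact e1.symm
  have i2 : K ∘ₘ (p2 - m) = p2 - m := by
    apply add_right_cancel_measure (m := m)
    conv_lhs => rw [← hKm, ← Measure.comp_add, hKm, e2, h2]
    exact e2.symm
  have hqq : (p1 - m).map Prod.fst = (p2 - m).map Prod.fst := by
    apply add_right_cancel_measure (m := m.map Prod.fst)
    rw [← Measure.map_add _ _ measurable_fst, ← Measure.map_add _ _ measurable_fst, e1, e2, hq]
  have s1 : (p1 - m) s = 0 := by rw [Measure.sub_apply hsm hm1, hms1, tsub_self]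
  have s2 : (p2 - m) sᶜ = 0 := by rw [Measure.sub_apply hsm.compl hm2, hms2, tsub_self]
  have z1 := singular_invariant_zero θ P V hV hVfin hsmall _ _ i1 i2 hqq s hsm s1 s2
  have z2 := singular_invariant_zero θ P V hV hVfin hsmall _ _ i2 i1 hqq.symm sᶜ hsm.compl s2
    (by rwa [compl_compl])
  rw [← e1, ← e2, z1, z2]


theorem meas_lint {α β γ : Type*} [MeasurableSpace α] [MeasurableSpace β] [MeasurableSpace γ]
    (κ : Kernel α β) [IsSFiniteKernel κ] (φ : γ → α) (hφ : Measurable φ) (f : γ → β → ℝ≥0∞)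
    (hf : Measurable fun p : γ × β => f p.1 p.2) : Measurable fun c => ∫⁻ b, f c b ∂(κ (φ c)) := by
  have := Measurable.lintegral_kernel_prod_right' (κ := κ.comap φ hφ) hf
  simpa [Kernel.comap_apply] using this

/-- prepend an element to a sequence -/
def consN {α : Type*} (a : α) (w : ℕ → α) : ℕ → α := fun n => Nat.casesOn n a w

@[simp] theorem consN_zero {α : Type*} (a : α) (w : ℕ → α) : consN a w 0 = a := rfl

@[simp] theorem consN_succ {α : Type*} (a : α) (w : ℕ → α) (n : ℕ) : consN a w (n + 1) = w n := rfl

theorem measurable_consN {α : Type*} [MeasurableSpace α] :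
    Measurable fun p : α × (ℕ → α) => consN p.1 p.2 := by
  rw [measurable_pi_iff]
  intro n
  cases n with
  | zero => exact measurable_fst
  | succ n => exact (measurable_pi_apply n).comp measurable_snd

/-- iterated random map -/
def rpath {S I : Type*} (f : S → I → S) : ℕ → S → (ℕ → I) → S
  | 0, s, _ => s
  | n + 1, s, u => rpath f n (f s (u 0)) (fun k => u (k + 1))

theorem measurable_rpath {S I : Type*} [MeasurableSpace S] [MeasurableSpace I] (f : S → I → S)
    (hf : Measurable (Function.uncurry f)) (n : ℕ) :
    Measurable fun p : S × (ℕ → I) => rpath f n p.1 p.2 := by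
  induction n with
  | zero => exact measurable_fst
  | succ n ih =>
    have h1 : Measurable fun p : S × (ℕ → I) => f p.1 (p.2 0) :=
      hf.comp (measurable_fst.prodMk ((measurable_pi_apply 0).comp measurable_snd))
    have h2 : Measurable fun p : S × (ℕ → I) => (fun k => p.2 (k + 1)) :=
      measurable_pi_iff.2 fun k => (measurable_pi_apply (k + 1)).comp measurable_snd
    exact ih.comp (h1.prodMk h2)

theorem lintegral_infinitePi_cons {I : Type*} [MeasurableSpace I] (m : Measure I)
    [IsProbabilityMeasure m] (g : (ℕ → I) → ℝ≥0∞) (hg : Measurable g) :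
    ∫⁻ u, g u ∂(Measure.infinitePi fun _ : ℕ => m) =
      ∫⁻ i, ∫⁻ u, g (consN i u) ∂(Measure.infinitePi fun _ : ℕ => m) ∂m := by
  set J := Measure.infinitePi fun _ : ℕ => m with hJ
  have key : (m.prod J).map (fun p => consN p.1 p.2) = J := by
    refine Measure.eq_infinitePi _ fun s t ht => ?_
    rw [Measure.map_apply measurable_consN (MeasurableSet.pi s.countable_toSet fun i _ => ht i)]
    -- enlarge to all of a range
    classical
    set t' : ℕ → Set I := fun i => if i ∈ s then t i else Set.univ with ht'
    have ht'm : ∀ i, MeasurableSet (t' i) := fun i => by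
      by_cases hi : i ∈ s <;> simp [ht', hi, ht i]
    obtain ⟨N, hN⟩ : ∃ N, s ⊆ Finset.range (N + 1) :=
      ⟨s.sup id, fun i hi => Finset.mem_range.2 (Nat.lt_succ_of_le (Finset.le_sup (f := id) hi))⟩
    have hset : (fun p : I × (ℕ → I) => consN p.1 p.2) ⁻¹' (Set.pi s t) =
        t' 0 ×ˢ Set.pi (Finset.range N) (fun k => t' (k + 1)) := by
      ext ⟨i, u⟩
      simp only [Set.mem_preimage, Set.mem_pi, Set.mem_prod, Finset.mem_coe, Finset.mem_range]
      constructor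
      · intro h
        refine ⟨?_, fun k hk => ?_⟩
        · by_cases h0 : 0 ∈ s
          · simpa [ht', h0] using h 0 h0
          · simp [ht', h0]
        · by_cases h0 : k + 1 ∈ s
          · simpa [ht', h0] using h _ h0
          · simp [ht', h0]
      · rintro ⟨h1, h2⟩ k hk
        cases k with
        | zero => simpa [ht', hk] using h1
        | succ k =>
          have := h2 k (by have := Finset.mem_range.1 (hN hk); omega)
          simpa [ht', hk] using this
    rw [hset, Measure.prod_prod, hJ, Measure.infinitePi_pi _ (fun k _ => ht'm (k + 1))]
    have : ∏ i ∈ s, m (t i) = ∏ i ∈ Finset.range (N + 1), m (t' i) := by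
      rw [← Finset.prod_subset hN (f := fun i => m (t' i))]
      · exact Finset.prod_congr rfl fun i hi => by simp [ht', hi]
      · intro i _ hi; simp [ht', hi]
    rw [this, Finset.prod_range_succ', mul_comm]
  conv_lhs => rw [← key]
  rw [lintegral_map hg measurable_consN]
  exact lintegral_prod _ (hg.comp measurable_consN).aemeasurable

theorem exists_pathKernel {S : Type*} [MeasurableSpace S] [StandardBorelSpace S] [Nonempty S]
    (K : Kernel S S) [IsMarkovKernel K] :
    ∃ T : Kernel S (ℕ → S), IsMarkovKernel T ∧ ∀ s (g : (ℕ → S) → ℝ≥0∞), Measurable g →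
      ∫⁻ w, g w ∂(T s) = ∫⁻ w, g (consN s w) ∂((T ∘ₖ K) s) := by
  obtain ⟨f, hf, hfK⟩ := Kernel.exists_measurable_map_eq_unitInterval K
  set J := Measure.infinitePi fun _ : ℕ => (volume : Measure unitInterval) with hJ
  set W : S × (ℕ → unitInterval) → (ℕ → S) := fun p n => rpath f n p.1 p.2 with hW
  have hWm : Measurable W := measurable_pi_iff.2 fun n => measurable_rpath f hf n
  set T : Kernel S (ℕ → S) := (Kernel.id ×ₖ Kernel.const S J).map W with hT
  have hTm : IsMarkovKernel T := Kernel.IsMarkovKernel.map _ hWm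
  have hTint : ∀ s (g : (ℕ → S) → ℝ≥0∞), Measurable g → 
      ∫⁻ w, g w ∂(T s) = ∫⁻ u, g (W (s, u)) ∂J := by
    intro s g hg
    rw [hT, Kernel.lintegral_map _ hWm _ hg, Kernel.lintegral_id_prod (by fun_prop),
      Kernel.const_apply]
  refine ⟨T, hTm, fun s g hg => ?_⟩
  have hcs : Measurable fun w : ℕ → S => consN s w :=
    measurable_consN.comp (measurable_const.prodMk measurable_id)
  rw [hTint s g hg, lintegral_infinitePi_cons _ _ (by fun_prop),
    Kernel.lintegral_comp _ _ _ (by fun_prop), ← hfK s, lintegral_map]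
  · refine lintegral_congr fun i => ?_
    rw [hTint _ _ (by fun_prop)]
    refine lintegral_congr fun u => ?_
    congr 1
    funext n
    cases n <;> rfl
  · exact Measurable.lintegral_kernel (by fun_prop)
  · exact hf.comp (measurable_const.prodMk measurable_id)


/-- glue past and future -/
def glueZ {S : Type*} (p : (ℕ → S) × (ℕ → S)) : ℤ → S
  | Int.ofNat n => p.2 n
  | Int.negSucc n => p.1 n

theorem measurable_glueZ {S : Type*} [MeasurableSpace S] :
    Measurable (glueZ : (ℕ → S) × (ℕ → S) → ℤ → S) := by
  rw [measurable_pi_iff]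
  intro t
  cases t with
  | ofNat n => exact (measurable_pi_apply n).comp measurable_snd
  | negSucc n => exact (measurable_pi_apply n).comp measurable_fst

theorem measurable_zshift {S : Type*} [MeasurableSpace S] :
    Measurable (zshift : (ℤ → S) → ℤ → S) :=
  measurable_pi_iff.2 fun t => measurable_pi_apply (t + 1)

theorem zshift_glueZ {S : Type*} (s : S) (w' w : ℕ → S) :
    zshift (glueZ (w', consN s w)) = glueZ (consN s w', w) := by
  funext t
  unfold zshift
  cases t with
  | ofNat n => rfl
  | negSucc n =>
    cases n with
    | zero => rfl
    | succ n =>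
      have : Int.negSucc (n + 1) + 1 = Int.negSucc n := by omega
      rw [this]; rfl

/-- the past of a two-sided path, in reverse order, starting from time `t` -/
def pastZ {S : Type*} (t : ℤ) (z : ℤ → S) : ℕ → S := fun n => z (t - n)

theorem measurable_pastZ {S : Type*} [MeasurableSpace S] (t : ℤ) :
    Measurable (pastZ t : (ℤ → S) → ℕ → S) :=
  measurable_pi_iff.2 fun n => measurable_pi_apply (t - n)

theorem pastZ_glueZ {S : Type*} (s : S) (w' w : ℕ → S) :
    pastZ 0 (glueZ (w', consN s w)) = consN s w' := by
  funext n
  unfold pastZ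
  cases n with
  | zero => rfl
  | succ n =>
    have : (0 : ℤ) - ((n + 1 : ℕ) : ℤ) = Int.negSucc n := by omega
    rw [this]; rfl

theorem exists_twosided {S : Type*} [MeasurableSpace S] [StandardBorelSpace S] [Nonempty S]
    (K : Kernel S S) [IsMarkovKernel K] (p : Measure S) [IsProbabilityMeasure p]
    (hp : K ∘ₘ p = p) :
    ∃ M : Measure (ℤ → S), IsProbabilityMeasure M ∧ M.map zshift = M ∧
      M.map (fun z => z 0) = p ∧ ∀ f : (ℕ → S) × S → ℝ≥0∞, Measurable f →
        ∫⁻ z, f (pastZ 0 z, z 1) ∂M = ∫⁻ z, ∫⁻ y, f (pastZ 0 z, y) ∂(K (z 0)) ∂M := by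
  set Ks : Kernel S S := posterior K p with hKs
  have hswap : p ⊗ₘ Ks = (p ⊗ₘ K).map Prod.swap := by
    have := compProd_posterior_eq_map_swap (κ := K) (μ := p)
    rwa [hp] at this
  have hswapI : ∀ H : S → S → ℝ≥0∞, Measurable (fun q : S × S => H q.1 q.2) →
      ∫⁻ s, ∫⁻ s1, H s1 s ∂(K s) ∂p = ∫⁻ s, ∫⁻ s1, H s s1 ∂(Ks s) ∂p := by
    intro H hH
    have h1 := Measure.lintegral_compProd (μ := p) (κ := Ks) hH
    have h2 := Measure.lintegral_compProd (μ := p) (κ := K) (f := fun q => H q.2 q.1)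
      (hH.comp measurable_swap)
    rw [← h1, ← h2, hswap, lintegral_map hH measurable_swap]
    rfl
  obtain ⟨T, hTm, hT⟩ := exists_pathKernel K
  obtain ⟨Ts, hTsm, hTs⟩ := exists_pathKernel Ks
  set B := Ts ∘ₖ Ks with hB
  set D := T ∘ₖ K with hD
  set M : Measure (ℤ → S) := ((B ×ₖ T) ∘ₘ p).map glueZ with hM
  have hMp : IsProbabilityMeasure M := Measure.isProbabilityMeasure_map measurable_glueZ.aemeasurable
  have hconsm : ∀ s : S, Measurable fun w : ℕ → S => consN s w := fun s =>
    measurable_consN.comp (measurable_const.prodMk measurable_id)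
  have hMint : ∀ g : (ℤ → S) → ℝ≥0∞, Measurable g →
      ∫⁻ z, g z ∂M = ∫⁻ s, ∫⁻ w', ∫⁻ w, g (glueZ (w', w)) ∂(T s) ∂(B s) ∂p := by
    intro g hg
    rw [hM, lintegral_map hg measurable_glueZ,
      Measure.lintegral_bind (f := fun a => g (glueZ a)) (Kernel.aemeasurable _)
        (hg.comp measurable_glueZ).aemeasurable]
    refine lintegral_congr fun s => ?_
    exact Kernel.lintegral_prod _ _ _ (hg.comp measurable_glueZ)
  have hgl : ∀ g : (ℤ → S) → ℝ≥0∞, Measurable g →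
      Measurable fun q : (ℕ → S) × (ℕ → S) => g (glueZ (q.1, q.2)) := fun g hg =>
    hg.comp measurable_glueZ
  have hMint2 : ∀ g : (ℤ → S) → ℝ≥0∞, Measurable g →
      ∫⁻ z, g z ∂M = ∫⁻ s, ∫⁻ w', ∫⁻ w, g (glueZ (w', consN s w)) ∂(D s) ∂(B s) ∂p := by
    intro g hg
    rw [hMint g hg]
    refine lintegral_congr fun s => lintegral_congr fun w' => ?_
    exact hT s (fun w => g (glueZ (w', w)))
      ((hgl g hg).comp (measurable_const.prodMk measurable_id))
  refine ⟨M, hMp, ?_, ?_, ?_⟩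
  · refine Measure.ext_of_lintegral _ fun g hg => ?_
    rw [lintegral_map hg measurable_zshift, hMint2 (fun z => g (zshift z)) (hg.comp measurable_zshift),
      hMint g hg]
    simp_rw [zshift_glueZ]
    set H : S → S → ℝ≥0∞ := fun s1 s =>
      ∫⁻ w, ∫⁻ w', g (glueZ (w', w)) ∂(Ts s) ∂(T s1) with hH
    have hHm : Measurable fun q : S × S => H q.1 q.2 := by
      refine meas_lint T (fun q : S × S => q.1) measurable_fst _ ?_
      refine meas_lint Ts (fun q : (S × S) × (ℕ → S) => q.1.2) (by fun_prop)
        (fun q w' => g (glueZ (w', q.2))) ?_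
      exact (hgl g hg).comp (measurable_snd.prodMk (measurable_snd.comp measurable_fst))
    calc ∫⁻ s, ∫⁻ w', ∫⁻ w, g (glueZ (consN s w', w)) ∂(D s) ∂(B s) ∂p
        = ∫⁻ s, ∫⁻ s1, H s1 s ∂(K s) ∂p := by
          refine lintegral_congr fun s => ?_
          rw [lintegral_lintegral_swap]
          · have h1 : ∀ w, ∫⁻ w', g (glueZ (consN s w', w)) ∂(B s) = 
                ∫⁻ w', g (glueZ (w', w)) ∂(Ts s) := fun w =>
              (hTs s (fun w' => g (glueZ (w', w)))
                ((hgl g hg).comp (measurable_id.prodMk measurable_const))).symm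
            simp_rw [h1]
            rw [hD, Kernel.lintegral_comp _ _ _]
            exact meas_lint Ts (fun _ : ℕ → S => s) measurable_const
              (fun w w' => g (glueZ (w', w))) ((hgl g hg).comp measurable_swap)
          · exact ((hgl g hg).comp (((hconsm s).comp measurable_fst).prodMk
              measurable_snd)).aemeasurable
      _ = ∫⁻ s, ∫⁻ s1, H s s1 ∂(Ks s) ∂p := hswapI H hHm
      _ = _ := by
          refine lintegral_congr fun s => ?_
          rw [hB, Kernel.lintegral_comp]
          · refine lintegral_congr fun s1 => ?_
            rw [hH]
            exact lintegral_lintegral_swap ((hgl g hg).comp measurable_swap).aemeasurable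
          · exact meas_lint T (fun _ : ℕ → S => s) measurable_const
              (fun w' w => g (glueZ (w', w))) (hgl g hg)
  · refine Measure.ext_of_lintegral _ fun g hg => ?_
    rw [lintegral_map hg (measurable_pi_apply 0),
      hMint2 (fun z => g (z 0)) (hg.comp (measurable_pi_apply 0))]
    refine lintegral_congr fun s => ?_
    have : ∀ w' w, glueZ (w', consN s w) 0 = s := fun w' w => rfl
    simp [this]
  · intro f hf
    have hm1 : Measurable fun z : ℤ → S => f (pastZ 0 z, z 1) :=
      hf.comp ((measurable_pastZ 0).prodMk (measurable_pi_apply 1))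
    have hm2 : Measurable fun z : ℤ → S => ∫⁻ y, f (pastZ 0 z, y) ∂(K (z 0)) :=
      meas_lint K (fun z : ℤ → S => z 0) (measurable_pi_apply 0) (fun z y => f (pastZ 0 z, y))
        (hf.comp (((measurable_pastZ 0).comp measurable_fst).prodMk measurable_snd))
    rw [hMint2 _ hm1, hMint2 _ hm2]
    refine lintegral_congr fun s => lintegral_congr fun w' => ?_
    have h0 : ∀ w, glueZ (w', consN s w) 0 = s := fun w => rfl
    have h1 : ∀ w, glueZ (w', consN s w) 1 = w 0 := fun w => rfl
    simp only [h0, h1, pastZ_glueZ]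
    have hfs : Measurable fun y => f (consN s w', y) := hf.comp (measurable_const.prodMk measurable_id)
    have hfs0 : Measurable fun w : ℕ → S => f (consN s w', w 0) :=
      hfs.comp (measurable_pi_apply (X := fun _ : ℕ => S) 0)
    rw [lintegral_const, measure_univ, mul_one, hD, Kernel.lintegral_comp _ _ _ hfs0]
    refine lintegral_congr fun s1 => ?_
    rw [hT s1 _ hfs0]
    simp


/-- environment plus strict past of the chain -/
def histMap (E F : Type*) (t : ℤ) (z : ℤ → E × F) : (ℤ → F) × ({s : ℤ // s < t} → E) :=
  (fun s => (z s).2, fun s : {s : ℤ // s < t} => (z s.1).1)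

theorem measurable_histMap {E F : Type*} [MeasurableSpace E] [MeasurableSpace F] (t : ℤ) :
    Measurable (histMap E F t) := by
  refine Measurable.prodMk (measurable_pi_iff.2 fun s => ?_) (measurable_pi_iff.2 fun s => ?_)
  · exact measurable_snd.comp (measurable_pi_apply s)
  · exact measurable_fst.comp (measurable_pi_apply s.1)

theorem histSigma_eq (E F : Type*) [MeasurableSpace E] [MeasurableSpace F] (t : ℤ) :
    histSigma E F t = MeasurableSpace.comap (histMap E F t) inferInstance := rfl

theorem mcre_iff {E F : Type*} [MeasurableSpace E] [MeasurableSpace F]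
    (P : Kernel (F × E) E) [IsMarkovKernel P] (μ : Measure (ℤ → E × F)) [IsProbabilityMeasure μ] :
    IsMCRESolution P μ ↔ ∀ (t : ℤ) (A : Set E), MeasurableSet A →
      ∀ C : Set ((ℤ → F) × ({s : ℤ // s < t} → E)), MeasurableSet C →
      μ ({z : ℤ → E × F | (z t).1 ∈ A} ∩ histMap E F t ⁻¹' C) =
        ∫⁻ z in histMap E F t ⁻¹' C, P ((z (t - 1)).2, (z (t - 1)).1) A ∂μ := by
  unfold IsMCRESolution
  refine forall_congr' fun t => forall_congr' fun A => forall_congr' fun hA => ?_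
  have hm : histSigma E F t ≤ (inferInstance : MeasurableSpace (ℤ → E × F)) := by
    rw [histSigma_eq]; exact (measurable_histMap t).comap_le
  have hAm : MeasurableSet {z : ℤ → E × F | (z t).1 ∈ A} :=
    (measurable_fst.comp (measurable_pi_apply t)) hA
  set f : (ℤ → E × F) → ℝ := ({z : ℤ → E × F | (z t).1 ∈ A}).indicator (fun _ => (1 : ℝ)) with hf
  have hfi : Integrable f μ := (integrable_const (1 : ℝ)).indicator hAm
  set k : (ℤ → E × F) → ℝ≥0∞ := fun z => P ((z (t - 1)).2, (z (t - 1)).1) A with hk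
  have hk1 : ∀ z, k z ≤ 1 := fun z => prob_le_one
  have hkm : Measurable k := (P.measurable_coe hA).comp
    (((measurable_snd.comp (measurable_pi_apply (t - 1)))).prodMk
      (measurable_fst.comp (measurable_pi_apply (t - 1))))
  have hkh : Measurable[histSigma E F t] fun z => (k z).toReal := by
    rw [histSigma_eq]
    have : Measurable fun c : (ℤ → F) × ({s : ℤ // s < t} → E) =>
        (P (c.1 (t - 1), c.2 ⟨t - 1, by omega⟩) A).toReal := by
      refine ((P.measurable_coe hA).comp (Measurable.prodMk ?_ ?_)).ennreal_toReal
      · exact (measurable_pi_apply (t - 1)).comp measurable_fst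
      · exact (measurable_pi_apply _).comp measurable_snd
    exact this.comp (comap_measurable _)
  have hki : Integrable (fun z => (k z).toReal) μ := by
    refine Integrable.of_bound hkm.ennreal_toReal.aestronglyMeasurable 1 (ae_of_all _ fun z => ?_)
    rw [Real.norm_of_nonneg ENNReal.toReal_nonneg]
    exact ENNReal.toReal_le_of_le_ofReal zero_le_one (by simpa using hk1 z)
  have hL : ∀ B, MeasurableSet B → ∫ z in B, f z ∂μ = (μ ({z : ℤ → E × F | (z t).1 ∈ A} ∩ B)).toReal := by
    intro B hB
    rw [hf, integral_indicator hAm, Measure.restrict_restrict hAm]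
    simp [Measure.real]
  have hR : ∀ B, MeasurableSet B → ∫ z in B, (k z).toReal ∂μ = (∫⁻ z in B, k z ∂μ).toReal := by
    intro B hB
    exact integral_toReal hkm.aemeasurable (ae_of_all _ fun z => (hk1 z).trans_lt ENNReal.one_lt_top)
  have hRfin : ∀ B, ∫⁻ z in B, k z ∂μ ≠ ∞ := fun B => by
    refine ne_top_of_le_ne_top (b := μ B) (measure_ne_top _ _) ?_
    calc ∫⁻ z in B, k z ∂μ ≤ ∫⁻ z in B, 1 ∂μ := lintegral_mono hk1
      _ = μ B := by simp
  constructor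
  · intro h C hC
    have hB := measurable_histMap (E := E) (F := F) t hC
    have hBh : MeasurableSet[histSigma E F t] (histMap E F t ⁻¹' C) := by
      rw [histSigma_eq]; exact ⟨C, hC, rfl⟩
    have h1 := setIntegral_condExp hm hfi hBh
    rw [setIntegral_congr_ae hB (h.mono fun z hz _ => hz), hL _ hB, hR _ hB] at h1
    exact ((ENNReal.toReal_eq_toReal_iff' (hRfin _) (measure_ne_top _ _)).1 h1).symm
  · intro h
    refine (ae_eq_condExp_of_forall_setIntegral_eq hm hfi (fun B _ _ => hki.integrableOn) ?_
      hkh.aestronglyMeasurable).symm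
    intro B hB _
    have hB' := hm _ hB
    rw [hL _ hB', hR _ hB']
    rw [histSigma_eq] at hB
    obtain ⟨C, hC, rfl⟩ := hB
    rw [h C hC]

/-- shift by an arbitrary integer -/
def shiftBy {α : Type*} (k : ℤ) (x : ℤ → α) : ℤ → α := fun t => x (t + k)

theorem measurable_shiftBy {α : Type*} [MeasurableSpace α] (k : ℤ) :
    Measurable (shiftBy k : (ℤ → α) → ℤ → α) :=
  measurable_pi_iff.2 fun t => measurable_pi_apply (t + k)

theorem map_shiftBy {α : Type*} [MeasurableSpace α] (μ : Measure (ℤ → α))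
    (h : μ.map zshift = μ) (k : ℤ) : μ.map (shiftBy k) = μ := by
  have hn : ∀ n : ℕ, μ.map (shiftBy (n : ℤ)) = μ := by
    intro n
    induction n with
    | zero =>
      have : (shiftBy ((0 : ℕ) : ℤ) : (ℤ → α) → ℤ → α) = id := by
        funext x t; simp [shiftBy]
      rw [this, Measure.map_id]
    | succ n ih =>
      have : (shiftBy ((n + 1 : ℕ) : ℤ) : (ℤ → α) → ℤ → α) = shiftBy (n : ℤ) ∘ zshift := by
        funext x t; simp [shiftBy, zshift, add_assoc]
      rw [this, ← Measure.map_map (measurable_shiftBy _) measurable_zshift, h, ih]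
  obtain ⟨n, rfl | rfl⟩ := k.eq_nat_or_neg
  · exact hn n
  · conv_lhs => rw [← hn n]
    rw [Measure.map_map (measurable_shiftBy _) (measurable_shiftBy _)]
    have : (shiftBy (-(n : ℤ)) ∘ shiftBy (n : ℤ) : (ℤ → α) → ℤ → α) = id := by
      funext x t; simp [shiftBy]
    rw [this, Measure.map_id]

/-- the shift on two-sided paths as a measurable equivalence -/
def shiftEquiv (F : Type*) [MeasurableSpace F] : (ℤ → F) ≃ᵐ (ℤ → F) where
  toFun := shiftBy 1
  invFun := shiftBy (-1)
  left_inv x := by funext t; simp [shiftBy]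
  right_inv x := by funext t; simp [shiftBy]
  measurable_toFun := measurable_shiftBy 1
  measurable_invFun := measurable_shiftBy (-1)

/-- the kernel on path space -/
def liftP {E F : Type*} [MeasurableSpace E] [MeasurableSpace F] (P : Kernel (F × E) E) :
    Kernel ((ℤ → F) × E) E :=
  P.comap (fun q => (q.1 0, q.2))
    (((measurable_pi_apply 0).comp measurable_fst).prodMk measurable_snd)

instance {E F : Type*} [MeasurableSpace E] [MeasurableSpace F] (P : Kernel (F × E) E)
    [IsMarkovKernel P] : IsMarkovKernel (liftP P) := by
  unfold liftP; infer_instance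

theorem liftP_apply {E F : Type*} [MeasurableSpace E] [MeasurableSpace F] (P : Kernel (F × E) E)
    (q : (ℤ → F) × E) : liftP P q = P (q.1 0, q.2) := rfl


theorem twosided_all {S : Type*} [MeasurableSpace S] (K : Kernel S S) [IsMarkovKernel K]
    (M : Measure (ℤ → S)) (hM : M.map zshift = M)
    (h : ∀ f : (ℕ → S) × S → ℝ≥0∞, Measurable f →
        ∫⁻ z, f (pastZ 0 z, z 1) ∂M = ∫⁻ z, ∫⁻ y, f (pastZ 0 z, y) ∂(K (z 0)) ∂M)
    (u : ℤ) (f : (ℕ → S) × S → ℝ≥0∞) (hf : Measurable f) :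
    ∫⁻ z, f (pastZ u z, z (u + 1)) ∂M = ∫⁻ z, ∫⁻ y, f (pastZ u z, y) ∂(K (z u)) ∂M := by
  have h1 := h f hf
  rw [← map_shiftBy M hM u, lintegral_map, lintegral_map] at h1
  · have e1 : ∀ z : ℤ → S, pastZ 0 (shiftBy u z) = pastZ u z := fun z => by
      funext n; simp only [pastZ, shiftBy]; congr 1; ring
    have e2 : ∀ z : ℤ → S, shiftBy u z 1 = z (u + 1) := fun z => by
      simp only [shiftBy]; congr 1; ring
    have e3 : ∀ z : ℤ → S, shiftBy u z 0 = z u := fun z => by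
      simp only [shiftBy]; congr 1; ring
    simpa only [e1, e2, e3] using h1
  · exact meas_lint K (fun z : ℤ → S => z 0) (measurable_pi_apply 0) (fun z y => f (pastZ 0 z, y))
        (hf.comp (((measurable_pastZ 0).comp measurable_fst).prodMk measurable_snd))
  · exact measurable_shiftBy u
  · exact hf.comp ((measurable_pastZ 0).prodMk (measurable_pi_apply 1))
  · exact measurable_shiftBy u

theorem exists_solution {E F : Type*} [MeasurableSpace E] [StandardBorelSpace E] [Nonempty E]
    [MeasurableSpace F] [StandardBorelSpace F] [Nonempty F] (P : Kernel (F × E) E)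
    [IsMarkovKernel P] (Q : Measure (ℤ → F)) (p : Measure ((ℤ → F) × E)) [IsProbabilityMeasure p]
    (hpQ : p.map Prod.fst = Q) (hp : (skewK (shiftEquiv F) (liftP P)) ∘ₘ p = p) :
    ∃ μ : Measure (ℤ → E × F), IsProbabilityMeasure μ ∧ μ.map zshift = μ ∧
      μ.map (fun z => fun t => (z t).2) = Q ∧ IsMCRESolution P μ := by
  set K := skewK (shiftEquiv F) (liftP P) with hK
  obtain ⟨M, hMp, hMs, hM0, hMk⟩ := exists_twosided K p hp
  have hMk' := twosided_all K M hMs hMk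
  -- consistency of environments
  have hae : ∀ᵐ z ∂M, ∀ t : ℤ, (z (t + 1)).1 = shiftBy 1 (z t).1 := by
    rw [ae_all_iff]
    intro t
    set D : Set ((ℕ → (ℤ → F) × E) × ((ℤ → F) × E)) := {q | q.2.1 = shiftBy 1 (q.1 0).1} with hD
    have hDm : MeasurableSet D := measurableSet_eq_fun (by fun_prop)
      ((measurable_shiftBy 1).comp (by fun_prop))
    have h1 := hMk' t (Dᶜ.indicator 1) (measurable_one.indicator hDm.compl)
    have h2 : ∀ z : ℤ → (ℤ → F) × E,
        ∫⁻ y, Dᶜ.indicator (1 : ((ℕ → (ℤ → F) × E) × ((ℤ → F) × E)) → ℝ≥0∞) (pastZ t z, y) ∂(K (z t)) = 0 := by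
      intro z
      rw [hK, lintegral_skewK _ _ (fun y => Dᶜ.indicator (1 : ((ℕ → (ℤ → F) × E) × ((ℤ → F) × E)) → ℝ≥0∞) (pastZ t z, y))
        ((measurable_one.indicator hDm.compl).comp measurable_prodMk_left)]
      have : ∀ y, Dᶜ.indicator (1 : ((ℕ → (ℤ → F) × E) × ((ℤ → F) × E)) → ℝ≥0∞) (pastZ t z, (shiftEquiv F (z t).1, y)) = 0 := by
        intro y
        refine Set.indicator_of_notMem ?_ _
        simp only [Set.mem_compl_iff, not_not]
        change shiftBy 1 (z t).1 = shiftBy 1 (pastZ t z 0).1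
        simp [pastZ]
      simp [this]
    simp only [h2, lintegral_zero] at h1
    have hm : Measurable fun z : ℤ → (ℤ → F) × E => (pastZ t z, z (t + 1)) :=
      (measurable_pastZ t).prodMk (measurable_pi_apply (t + 1))
    rw [lintegral_eq_zero_iff (f := fun z : ℤ → (ℤ → F) × E => Dᶜ.indicator (1 : ((ℕ → (ℤ → F) × E) × ((ℤ → F) × E)) → ℝ≥0∞) (pastZ t z, z (t + 1)))
      ((measurable_one.indicator hDm.compl).comp hm)] at h1
    filter_upwards [h1] with z hz
    by_contra hne
    have : (pastZ t z, z (t + 1)) ∈ Dᶜ := by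
      intro hmem
      have h3 : (z (t + 1)).1 = shiftBy 1 (pastZ t z 0).1 := hmem
      exact hne (by simpa [pastZ] using h3)
    simp [this] at hz
  have hae2 : ∀ᵐ z ∂M, ∀ s t : ℤ, (z s).1 0 = (z t).1 (s - t) := by
    filter_upwards [hae] with z hz
    have hn : ∀ n : ℕ, ∀ t r : ℤ, (z (t + n)).1 r = (z t).1 (r + n) := by
      intro n
      induction n with
      | zero => intro t r; simp
      | succ n ih =>
        intro t r
        have : t + ((n + 1 : ℕ) : ℤ) = (t + n) + 1 := by push_cast; ring
        rw [this, hz, shiftBy, ih]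
        congr 1; push_cast; ring
    intro s t
    rcases le_total t s with h | h
    · obtain ⟨n, hn'⟩ := Int.le.dest h
      subst hn'; rw [hn]; congr 1; ring
    · obtain ⟨n, hn'⟩ := Int.le.dest h
      subst hn'; rw [hn]; congr 1; ring
  set φ : (ℤ → (ℤ → F) × E) → (ℤ → E × F) := fun z t => ((z t).2, (z t).1 0) with hφ
  have hφm : Measurable φ := measurable_pi_iff.2 fun t =>
    (measurable_snd.comp (measurable_pi_apply t)).prodMk
      ((measurable_pi_apply 0).comp (measurable_fst.comp (measurable_pi_apply t)))
  have hsnd : Measurable fun z : ℤ → E × F => fun t => (z t).2 :=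
    measurable_pi_iff.2 fun t => measurable_snd.comp (measurable_pi_apply t)
  have hμp : IsProbabilityMeasure (M.map φ) := Measure.isProbabilityMeasure_map hφm.aemeasurable
  refine ⟨M.map φ, hμp, ?_, ?_, ?_⟩
  · rw [Measure.map_map measurable_zshift hφm]
    have : zshift ∘ φ = φ ∘ zshift := rfl
    rw [this, ← Measure.map_map hφm measurable_zshift, hMs]
  · rw [Measure.map_map hsnd hφm, ← hpQ, ← hM0, Measure.map_map measurable_fst (measurable_pi_apply 0)]
    refine Measure.map_congr ?_
    filter_upwards [hae2] with z hz
    funext t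
    simpa [hφ] using hz t 0
  · rw [mcre_iff]
    intro t A hA C hC
    have hAm : MeasurableSet {z : ℤ → E × F | (z t).1 ∈ A} :=
      (measurable_fst.comp (measurable_pi_apply t)) hA
    have hCm : MeasurableSet (histMap E F t ⁻¹' C) := measurable_histMap t hC
    have hkm : Measurable fun z : ℤ → E × F => P ((z (t - 1)).2, (z (t - 1)).1) A :=
      (P.measurable_coe hA).comp
      (((measurable_snd.comp (measurable_pi_apply (t - 1)))).prodMk
        (measurable_fst.comp (measurable_pi_apply (t - 1))))
    set u := t - 1 with hu
    set Hc : (ℕ → (ℤ → F) × E) → (ℤ → F) × ({s : ℤ // s < t} → E) := fun w =>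
      (fun s => (w 0).1 (s - u), fun s => (w (u - s.1).toNat).2) with hHc
    have hHcm : Measurable Hc := by
      refine Measurable.prodMk (measurable_pi_iff.2 fun s => ?_) (measurable_pi_iff.2 fun s => ?_)
      · exact (measurable_pi_apply (s - u)).comp (measurable_fst.comp (measurable_pi_apply 0))
      · exact measurable_snd.comp (measurable_pi_apply _)
    have hH : ∀ᵐ z ∂M, histMap E F t (φ z) = Hc (pastZ u z) := by
      filter_upwards [hae2] with z hz
      refine Prod.ext ?_ ?_
      · funext s
        simpa [histMap, hφ, hHc, pastZ] using hz s u
      · funext s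
        have hs : u - (((u - s.1).toNat : ℕ) : ℤ) = s.1 := by
          have := s.2; omega
        simp only [histMap, hφ, hHc, pastZ]
        rw [hs]
    have hCc : MeasurableSet (Hc ⁻¹' C) := hHcm hC
    set f : (ℕ → (ℤ → F) × E) × ((ℤ → F) × E) → ℝ≥0∞ := fun q =>
      (Hc ⁻¹' C).indicator 1 q.1 * A.indicator 1 q.2.2 with hf
    have hfm : Measurable f := ((measurable_one.indicator hCc).comp measurable_fst).mul
      ((measurable_one.indicator hA).comp (measurable_snd.comp measurable_snd))
    have h1 := hMk' u f hfm
    have hut : u + 1 = t := by omega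
    rw [hut] at h1
    calc (M.map φ) ({z : ℤ → E × F | (z t).1 ∈ A} ∩ histMap E F t ⁻¹' C)
        = ∫⁻ z, f (pastZ u z, z t) ∂M := by
          rw [← lintegral_indicator_one (hAm.inter hCm),
            lintegral_map (measurable_one.indicator (hAm.inter hCm)) hφm]
          refine lintegral_congr_ae ?_
          filter_upwards [hH] with z hz
          have i1 : φ z ∈ {z : ℤ → E × F | (z t).1 ∈ A} ↔ (z t).2 ∈ A := Iff.rfl
          have i2 : φ z ∈ histMap E F t ⁻¹' C ↔ pastZ u z ∈ Hc ⁻¹' C := by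
            rw [Set.mem_preimage, hz, Set.mem_preimage]
          by_cases c1 : (z t).2 ∈ A <;> by_cases c2 : pastZ u z ∈ Hc ⁻¹' C
          · rw [Set.indicator_of_mem (Set.mem_inter (i1.2 c1) (i2.2 c2))]; simp only [hf]
            rw [Set.indicator_of_mem c1, Set.indicator_of_mem c2]; simp
          · rw [Set.indicator_of_notMem (fun h => c2 (i2.1 h.2))]; simp only [hf]
            rw [Set.indicator_of_notMem c2]; simp
          · rw [Set.indicator_of_notMem (fun h => c1 (i1.1 h.1))]; simp only [hf]
            rw [Set.indicator_of_notMem c1]; simp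
          · rw [Set.indicator_of_notMem (fun h => c1 (i1.1 h.1))]; simp only [hf]
            rw [Set.indicator_of_notMem c1]; simp
      _ = ∫⁻ z, ∫⁻ y, f (pastZ u z, y) ∂(K (z u)) ∂M := h1
      _ = ∫⁻ z in histMap E F t ⁻¹' C, P ((z u).2, (z u).1) A ∂(M.map φ) := by
          rw [← lintegral_indicator hCm, lintegral_map (hkm.indicator hCm) hφm]
          refine lintegral_congr_ae ?_
          filter_upwards [hH] with z hz
          have i2 : φ z ∈ histMap E F t ⁻¹' C ↔ pastZ u z ∈ Hc ⁻¹' C := by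
            rw [Set.mem_preimage, hz, Set.mem_preimage]
          rw [hK, lintegral_skewK _ _ (fun y => f (pastZ u z, y))
            (hfm.comp measurable_prodMk_left)]
          simp only [hf]
          rw [lintegral_const_mul _ (measurable_one.indicator hA), lintegral_indicator_one hA,
            liftP_apply]
          by_cases c2 : pastZ u z ∈ Hc ⁻¹' C
          · rw [Set.indicator_of_mem (i2.2 c2), Set.indicator_of_mem c2]
            simp [hφ]
          · rw [Set.indicator_of_notMem (fun h => c2 (i2.1 h)), Set.indicator_of_notMem c2]
            simp


/-- environment together with the chain on times `0..n` -/
def segMap (E F : Type*) (n : ℕ) (z : ℤ → E × F) : (ℤ → F) × (ℕ → E) :=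
  (fun s => (z s).2, fun k => (z ((min k n : ℕ) : ℤ)).1)

theorem measurable_segMap {E F : Type*} [MeasurableSpace E] [MeasurableSpace F] (n : ℕ) :
    Measurable (segMap E F n) := by
  refine Measurable.prodMk (measurable_pi_iff.2 fun s => ?_) (measurable_pi_iff.2 fun s => ?_)
  · exact measurable_snd.comp (measurable_pi_apply s)
  · exact measurable_fst.comp (measurable_pi_apply _)

/-- one step kernel on segments -/
def segK {E F : Type*} [MeasurableSpace E] [MeasurableSpace F] (P : Kernel (F × E) E) (n : ℕ) :
    Kernel ((ℤ → F) × (ℕ → E)) E :=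
  P.comap (fun c => (c.1 (n : ℤ), c.2 n))
    (((measurable_pi_apply _).comp measurable_fst).prodMk
      ((measurable_pi_apply _).comp measurable_snd))

instance {E F : Type*} [MeasurableSpace E] [MeasurableSpace F] (P : Kernel (F × E) E)
    [IsMarkovKernel P] (n : ℕ) : IsMarkovKernel (segK P n) := by
  unfold segK; infer_instance

theorem segK_apply {E F : Type*} [MeasurableSpace E] [MeasurableSpace F] (P : Kernel (F × E) E)
    (n : ℕ) (c : (ℤ → F) × (ℕ → E)) : segK P n c = P (c.1 (n : ℤ), c.2 n) := rfl

theorem seg_joint {E F : Type*} [MeasurableSpace E] [MeasurableSpace F]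
    (P : Kernel (F × E) E) [IsMarkovKernel P] (μ : Measure (ℤ → E × F)) [IsProbabilityMeasure μ]
    (h : IsMCRESolution P μ) (n : ℕ) :
    μ.map (fun z => (segMap E F n z, (z ((n : ℤ) + 1)).1)) = (μ.map (segMap E F n)) ⊗ₘ segK P n := by
  have hY : Measurable fun z : ℤ → E × F => (z ((n : ℤ) + 1)).1 :=
    measurable_fst.comp (measurable_pi_apply _)
  have hm := (measurable_segMap (E := E) (F := F) n).prodMk hY
  have := Measure.isProbabilityMeasure_map (μ := μ) hm.aemeasurable
  have := Measure.isProbabilityMeasure_map (μ := μ)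
    (measurable_segMap (E := E) (F := F) n).aemeasurable
  refine Measure.ext_prod fun {C A} hC hA => ?_
  rw [Measure.map_apply hm (hC.prod hA), Measure.compProd_apply_prod hC hA,
    setLIntegral_map hC ((segK P n).measurable_coe hA) (measurable_segMap n)]
  set t : ℤ := (n : ℤ) + 1 with ht
  set g : (ℤ → F) × ({s : ℤ // s < t} → E) → (ℤ → F) × (ℕ → E) := fun c =>
    (c.1, fun k => c.2 ⟨((min k n : ℕ) : ℤ), by omega⟩) with hg
  have hgm : Measurable g := by
    refine Measurable.prodMk measurable_fst (measurable_pi_iff.2 fun s => ?_)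
    exact (measurable_pi_apply _).comp measurable_snd
  have h1 := (mcre_iff P μ).1 h t A hA (g ⁻¹' C) (hgm hC)
  have e1 : histMap E F t ⁻¹' (g ⁻¹' C) = segMap E F n ⁻¹' C := rfl
  have e2 : (fun z : ℤ → E × F => (segMap E F n z, (z t).1)) ⁻¹' C ×ˢ A =
      {z : ℤ → E × F | (z t).1 ∈ A} ∩ histMap E F t ⁻¹' (g ⁻¹' C) := by
    ext z
    exact and_comm
  rw [e2, h1, e1]
  have e3 : t - 1 = n := by omega
  rw [e3]
  refine lintegral_congr fun z => ?_
  rw [segK_apply]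
  simp [segMap]

/-- environment together with the chain at time zero -/
def pairMap (E F : Type*) (z : ℤ → E × F) : (ℤ → F) × E := (fun s => (z s).2, (z 0).1)

theorem measurable_pairMap {E F : Type*} [MeasurableSpace E] [MeasurableSpace F] :
    Measurable (pairMap E F) := by
  refine Measurable.prodMk (measurable_pi_iff.2 fun s => ?_) ?_
  · exact measurable_snd.comp (measurable_pi_apply s)
  · exact measurable_fst.comp (measurable_pi_apply _)

theorem pair_invariant {E F : Type*} [MeasurableSpace E] [MeasurableSpace F]
    (P : Kernel (F × E) E) [IsMarkovKernel P] (μ : Measure (ℤ → E × F)) [IsProbabilityMeasure μ]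
    (hs : μ.map zshift = μ) (h : IsMCRESolution P μ) :
    (skewK (shiftEquiv F) (liftP P)) ∘ₘ (μ.map (pairMap E F)) = μ.map (pairMap E F) := by
  ext B hB
  have hj := seg_joint P μ h 0
  have hY : Measurable fun z : ℤ → E × F => (z (((0 : ℕ) : ℤ) + 1)).1 :=
    measurable_fst.comp (measurable_pi_apply _)
  have hm := (measurable_segMap (E := E) (F := F) 0).prodMk hY
  have := Measure.isProbabilityMeasure_map (μ := μ)
    (measurable_segMap (E := E) (F := F) 0).aemeasurable
  set g : ((ℤ → F) × (ℕ → E)) × E → (ℤ → F) × E := fun q => (shiftBy 1 q.1.1, q.2) with hg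
  have hgm : Measurable g :=
    ((measurable_shiftBy 1).comp (measurable_fst.comp measurable_fst)).prodMk measurable_snd
  have h1 := congrArg (fun m => m (g ⁻¹' B)) hj
  rw [Measure.map_apply hm (hgm hB), Measure.compProd_apply (hgm hB),
    lintegral_map (Kernel.measurable_kernel_prodMk_left (hgm hB)) (measurable_segMap 0)] at h1
  rw [Measure.bind_apply hB (Kernel.aemeasurable _),
    lintegral_map (Kernel.measurable_coe _ hB) measurable_pairMap]
  have h2 : μ.map (pairMap E F) B = μ ((fun z : ℤ → E × F =>
      (segMap E F 0 z, (z (((0 : ℕ) : ℤ) + 1)).1)) ⁻¹' (g ⁻¹' B)) := by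
    conv_lhs => rw [← map_shiftBy μ hs 1, Measure.map_map measurable_pairMap (measurable_shiftBy 1)]
    rw [Measure.map_apply (measurable_pairMap.comp (measurable_shiftBy 1)) hB]
    rfl
  rw [h2, h1]
  refine lintegral_congr fun z => ?_
  rw [skewK_apply _ _ _ hB, liftP_apply, segK_apply]
  rfl

theorem mcre_unique {E F : Type*} [MeasurableSpace E] [MeasurableSpace F]
    (P : Kernel (F × E) E) [IsMarkovKernel P] (μ1 μ2 : Measure (ℤ → E × F))
    [IsProbabilityMeasure μ1] [IsProbabilityMeasure μ2]
    (hs1 : μ1.map zshift = μ1) (h1 : IsMCRESolution P μ1)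
    (hs2 : μ2.map zshift = μ2) (h2 : IsMCRESolution P μ2)
    (hpair : μ1.map (pairMap E F) = μ2.map (pairMap E F)) : μ1 = μ2 := by
  have hseg : ∀ n : ℕ, μ1.map (segMap E F n) = μ2.map (segMap E F n) := by
    intro n
    induction n with
    | zero =>
      set g : (ℤ → F) × E → (ℤ → F) × (ℕ → E) := fun q => (q.1, fun _ => q.2) with hg
      have hgm : Measurable g :=
        measurable_fst.prodMk (measurable_pi_iff.2 fun _ => measurable_snd)
      have e : segMap E F 0 = g ∘ pairMap E F := by
        funext z; simp [segMap, hg, pairMap]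
      rw [e, ← Measure.map_map hgm measurable_pairMap, hpair,
        Measure.map_map hgm measurable_pairMap]
    | succ n ih =>
      have hY : Measurable fun z : ℤ → E × F => (z ((n : ℤ) + 1)).1 :=
        measurable_fst.comp (measurable_pi_apply _)
      have hm := (measurable_segMap (E := E) (F := F) n).prodMk hY
      set g : ((ℤ → F) × (ℕ → E)) × E → (ℤ → F) × (ℕ → E) := fun q =>
        (q.1.1, fun k => if k ≤ n then q.1.2 k else q.2) with hg
      have hgm : Measurable g := by
        refine (measurable_fst.comp measurable_fst).prodMk (measurable_pi_iff.2 fun k => ?_)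
        by_cases hk : k ≤ n
        · simp only [hk, if_true]
          exact (measurable_pi_apply k).comp (measurable_snd.comp measurable_fst)
        · simp only [hk, if_false]
          exact measurable_snd
      have e : segMap E F (n + 1) = g ∘ fun z => (segMap E F n z, (z ((n : ℤ) + 1)).1) := by
        funext z
        refine Prod.ext rfl ?_
        funext k
        simp only [segMap, hg, Function.comp]
        split_ifs with hk
        · rw [min_eq_left hk, min_eq_left (by omega)]
        · rw [min_eq_right (by omega)]; push_cast; rfl
      rw [e, ← Measure.map_map hgm hm, ← Measure.map_map hgm hm, seg_joint P μ1 h1 n,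
        seg_joint P μ2 h2 n, ih]
  refine IsProjectiveLimit.unique (P := fun I : Finset ℤ => μ2.map I.restrict) ?_ (fun I => rfl)
  intro I
  obtain ⟨m, hmI⟩ : ∃ m : ℕ, ∀ t ∈ I, |t| ≤ m := by
    refine ⟨∑ t ∈ I, t.natAbs, fun t ht => ?_⟩
    have := Finset.single_le_sum (f := fun t : ℤ => t.natAbs) (fun _ _ => Nat.zero_le _) ht
    rw [Int.abs_eq_natAbs]
    exact_mod_cast this
  set H : (ℤ → F) × (ℕ → E) → (I → E × F) := fun c t =>
    (c.2 (t.1 + m).toNat, c.1 (t.1 + m)) with hH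
  have hHm : Measurable H := measurable_pi_iff.2 fun t =>
    ((measurable_pi_apply _).comp measurable_snd).prodMk
      ((measurable_pi_apply _).comp measurable_fst)
  have hIm : Measurable (I.restrict : (ℤ → E × F) → (I → E × F)) :=
    measurable_pi_iff.2 fun t => measurable_pi_apply t.1
  have e : (I.restrict : (ℤ → E × F) → (I → E × F)) ∘ shiftBy (m : ℤ) =
      H ∘ segMap E F (2 * m) := by
    funext z t
    have hh := abs_le.1 (hmI t.1 t.2)
    have h3 : ((min (t.1 + m).toNat (2 * m) : ℕ) : ℤ) = t.1 + m := by omega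
    simp only [Function.comp, hH, segMap, Finset.restrict, shiftBy, h3]
  have key : ∀ μ : Measure (ℤ → E × F), μ.map zshift = μ →
      μ.map I.restrict = (μ.map (segMap E F (2 * m))).map H := by
    intro μ hμ
    rw [Measure.map_map hHm (measurable_segMap _), ← e,
      ← Measure.map_map hIm (measurable_shiftBy _), map_shiftBy μ hμ]
  change μ1.map I.restrict = μ2.map I.restrict
  rw [key μ1 hs1, key μ2 hs2, hseg]


theorem drift_rec (lam b : ℕ → ℝ) (v : ℝ) (n : ℕ) :
    v * ∏ i ∈ Finset.range (n + 1), lam i +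
      ∑ k ∈ Finset.range (n + 1), b k * ∏ i ∈ Finset.range k, lam i =
    lam 0 * (v * ∏ i ∈ Finset.range n, lam (i + 1) +
      ∑ k ∈ Finset.range n, b (k + 1) * ∏ i ∈ Finset.range k, lam (i + 1)) + b 0 := by
  rw [Finset.prod_range_succ', Finset.sum_range_succ' , mul_add, Finset.mul_sum]
  have : ∀ k, b (k + 1) * ∏ i ∈ Finset.range (k + 1), lam i =
      lam 0 * (b (k + 1) * ∏ i ∈ Finset.range k, lam (i + 1)) := by
    intro k; rw [Finset.prod_range_succ']; ring
  simp only [this, Finset.range_zero, Finset.prod_empty]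
  ring

theorem iterate_shiftBy {α : Type*} (i : ℕ) (x : ℤ → α) :
    (shiftBy (-1))^[i] x = shiftBy (-(i : ℤ)) x := by
  induction i with
  | zero => funext t; simp [shiftBy]
  | succ n ih =>
    rw [Function.iterate_succ_apply', ih]
    funext t
    simp only [shiftBy]
    congr 1; push_cast; ring

theorem existence_uniqueness_stationary_MCRE
    {E F : Type*}
    [MeasurableSpace E] [TopologicalSpace E] [PolishSpace E] [BorelSpace E]
    [MeasurableSpace F] [TopologicalSpace F] [PolishSpace F] [BorelSpace F]
    {Ω : Type*} [MeasurableSpace Ω] (Pr : Measure Ω) [IsProbabilityMeasure Pr]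
    (X : ℤ → Ω → F) (hX : ∀ t, Measurable (X t))
    (P : Kernel (F × E) E) [IsMarkovKernel P]
    -- A1 : the environment is stationary
    (hstat : (Pr.map fun ω => fun t => X t ω).map zshift = Pr.map fun ω => fun t => X t ω)
    -- A2 : drift condition with random coefficients
    (V : E → ℝ) (hVmeas : Measurable V) (hVpos : ∀ y, 0 < V y)
    (lam b : F → ℝ) (hlam : Measurable lam) (hb : Measurable b)
    (hlam0 : ∀ x, 0 ≤ lam x) (hb0 : ∀ x, 0 ≤ b x)
    (hlamlog : ∫⁻ ω, ENNReal.ofReal (Real.log (max (lam (X 0 ω)) 1)) ∂Pr < ∞)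
    (hblog : ∫⁻ ω, ENNReal.ofReal (Real.log (max (b (X 0 ω)) 1)) ∂Pr < ∞)
    (hdrift : ∀ (x : F) (y : E), ∫⁻ z, ENNReal.ofReal (V z) ∂(P (x, y)) ≤
      ENNReal.ofReal (lam x) * ENNReal.ofReal (V y) + ENNReal.ofReal (b x))
    (hlyap : ∀ᵐ ω ∂Pr, atTop.limsup
      (fun n : ℕ => (∏ i ∈ Finset.range n, lam (X (-(i : ℤ) - 1) ω)) ^ ((n : ℝ)⁻¹)) < 1)
    -- A3 : sublevel sets of V are small sets, uniformly in the environment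
    (η : ℝ → F → ℝ) (hηmeas : Measurable fun p : ℝ × F => η p.1 p.2)
    (hη01 : ∀ R > (0 : ℝ), ∀ x, η R x ∈ Set.Ioo (0 : ℝ) 1)
    (hsmall : ∀ R > (0 : ℝ), ∃ ν : Kernel F E, IsMarkovKernel ν ∧
      ∀ (x : F) (y : E) (A : Set E), MeasurableSet A → V y ≤ R →
        ENNReal.ofReal (η R x) * ν x A ≤ P (x, y) A) :
    -- existence of a stationary solution with environment X
    (∃ μ : Measure (ℤ → E × F), IsProbabilityMeasure μ ∧
      μ.map zshift = μ ∧
      μ.map (fun z => fun t => (z t).2) = Pr.map (fun ω => fun t => X t ω) ∧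
      IsMCRESolution P μ) ∧
    -- uniqueness in distribution
    (∀ μ₁ μ₂ : Measure (ℤ → E × F),
      (IsProbabilityMeasure μ₁ ∧ μ₁.map zshift = μ₁ ∧
        μ₁.map (fun z => fun t => (z t).2) = Pr.map (fun ω => fun t => X t ω) ∧
        IsMCRESolution P μ₁) →
      (IsProbabilityMeasure μ₂ ∧ μ₂.map zshift = μ₂ ∧
        μ₂.map (fun z => fun t => (z t).2) = Pr.map (fun ω => fun t => X t ω) ∧
        IsMCRESolution P μ₂) →
      μ₁ = μ₂) := by
  have hXm : Measurable fun ω => fun t => X t ω := measurable_pi_iff.2 hX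
  set Q : Measure (ℤ → F) := Pr.map fun ω => fun t => X t ω with hQdef
  have hQp : IsProbabilityMeasure Q := Measure.isProbabilityMeasure_map hXm.aemeasurable
  have hΩ : Nonempty Ω := Pr.nonempty_of_neZero
  have hF : Nonempty F := ⟨X 0 hΩ.some⟩
  have hE : Nonempty E := by
    obtain ⟨ν, hν, -⟩ := hsmall 1 one_pos
    exact (ν hF.some).nonempty_of_neZero
  have hsb : ∀ k : ℤ, MeasurePreserving (shiftBy k) Q Q := fun k =>
    ⟨measurable_shiftBy k, map_shiftBy Q hstat k⟩
  set W : E → ℝ≥0∞ := fun y => ENNReal.ofReal (V y) with hW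
  have hWm : Measurable W := hVmeas.ennreal_ofReal
  have hsmall' : ∀ R : ℕ, ∃ ν : Kernel (ℤ → F) E, IsMarkovKernel ν ∧ ∃ e : (ℤ → F) → ℝ≥0∞,
      Measurable e ∧ (∀ x, e x ≠ 0) ∧ (∀ x, e x ≤ 1) ∧
      ∀ x y A, MeasurableSet A → W y ≤ R → e x * ν x A ≤ liftP P (x, y) A := by
    intro R
    have hR : (0 : ℝ) < (R : ℝ) + 1 := by positivity
    obtain ⟨ν, hν, h⟩ := hsmall (R + 1) hR
    refine ⟨ν.comap (fun x => x 0) (measurable_pi_apply 0), inferInstance,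
      fun x => ENNReal.ofReal (η (R + 1) (x 0)), ?_, fun x => ?_, fun x => ?_, ?_⟩
    · exact (hηmeas.comp ((measurable_const (a := (R : ℝ) + 1)).prodMk
        (measurable_pi_apply 0))).ennreal_ofReal
    · exact (ENNReal.ofReal_pos.2 (hη01 _ hR _).1).ne'
    · exact ENNReal.ofReal_le_one.2 (hη01 _ hR _).2.le
    · intro x y A hA hy
      rw [liftP_apply, Kernel.comap_apply]
      refine h (x 0) y A hA ?_
      have h3 : V y ≤ R := by
        have h4 : ENNReal.ofReal (V y) ≤ (R : ℝ≥0∞) := hy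
        rwa [← ENNReal.ofReal_natCast, ENNReal.ofReal_le_ofReal_iff (Nat.cast_nonneg R)] at h4
      linarith
  constructor
  · set y0 : E := hE.some
    set u : ℕ → (ℤ → F) → ℝ := fun n x =>
      V y0 * ∏ i ∈ Finset.range n, lam (x (-(i : ℤ) - 1)) +
        ∑ k ∈ Finset.range n, b (x (-(k : ℤ) - 1)) *
          ∏ i ∈ Finset.range k, lam (x (-(i : ℤ) - 1)) with hu
    have hum : ∀ n, Measurable (u n) := by
      intro n
      have hl' : ∀ i : ℕ, Measurable fun x : ℤ → F => lam (x (-(i : ℤ) - 1)) := fun i =>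
        hlam.comp (measurable_pi_apply _)
      have hb' : ∀ i : ℕ, Measurable fun x : ℤ → F => b (x (-(i : ℤ) - 1)) := fun i =>
        hb.comp (measurable_pi_apply _)
      have hp' : ∀ k : ℕ, Measurable fun x : ℤ → F =>
          ∏ i ∈ Finset.range k, lam (x (-(i : ℤ) - 1)) := fun k =>
        Finset.measurable_fun_prod _ fun i _ => hl' i
      exact ((hp' n).const_mul _).add
        (Finset.measurable_fun_sum _ fun k _ => (hb' k).mul (hp' k))
    have hu0 : ∀ n x, 0 ≤ u n x := fun n x => add_nonneg
      (mul_nonneg (hVpos _).le (Finset.prod_nonneg fun i _ => hlam0 _))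
      (Finset.sum_nonneg fun k _ => mul_nonneg (hb0 _) (Finset.prod_nonneg fun i _ => hlam0 _))
    -- integrability transfer
    have hintg : ∀ g : F → ℝ, Measurable g →
        ∫⁻ ω, ENNReal.ofReal (Real.log (max (g (X 0 ω)) 1)) ∂Pr < ∞ →
        Measurable (fun x : ℤ → F => Real.log (max (g (x (-1))) 1)) ∧
        Integrable (fun x : ℤ → F => Real.log (max (g (x (-1))) 1)) Q ∧
        ∀ x : ℤ → F, 0 ≤ Real.log (max (g (x (-1))) 1) := by
      intro g hg hfin
      have hm : ∀ k : ℤ, Measurable (fun x : ℤ → F => Real.log (max (g (x k)) 1)) := fun k =>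
        ((hg.comp (measurable_pi_apply k)).max measurable_const).log
      have hnn : ∀ (k : ℤ) (x : ℤ → F), 0 ≤ Real.log (max (g (x k)) 1) := fun k x =>
        Real.log_nonneg (le_max_right _ _)
      have h0 : Integrable (fun x : ℤ → F => Real.log (max (g (x 0)) 1)) Q := by
        refine ⟨(hm 0).aestronglyMeasurable, ?_⟩
        rw [hasFiniteIntegral_iff_ofReal (ae_of_all _ (hnn 0)), hQdef,
          lintegral_map (hm 0).ennreal_ofReal hXm]
        exact hfin
      have h1 := (hsb (-1)).integrable_comp_of_integrable h0
      refine ⟨hm (-1), ?_, hnn (-1)⟩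
      refine h1.congr (ae_of_all _ fun x => ?_)
      simp [shiftBy, Function.comp]
    obtain ⟨l1, l2, l3⟩ := hintg lam hlam hlamlog
    obtain ⟨b1, b2, b3⟩ := hintg b hb hblog
    have hA := ae_of_ae_map hXm.aemeasurable (ae_sum_bounded Q (shiftBy (-1)) (hsb (-1)) _ l1 l2 l3)
    have hB := ae_of_ae_map hXm.aemeasurable (ae_all_iff.2 fun j : ℕ =>
      ae_sublinear Q (shiftBy (-1)) (hsb (-1)) _ b1 b2 b3 (1 / ((j : ℝ) + 1)) (by positivity))
    have hidx : ∀ (i : ℕ) (x : ℤ → F), (shiftBy (-1))^[i] x (-1) = x (-(i : ℤ) - 1) := by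
      intro i x
      rw [iterate_shiftBy, shiftBy]; congr 1; ring
    simp only [hidx] at hA hB
    have hbd : ∀ᵐ ω ∂Pr, ∃ c : ℕ, ∀ n, u n (fun t => X t ω) ≤ c := by
      filter_upwards [hA, hB, hlyap] with ω h1 h2 h3
      obtain ⟨c, hc⟩ := det_bound (fun i => lam (X (-(i : ℤ) - 1) ω))
        (fun i => b (X (-(i : ℤ) - 1) ω)) (fun i => hlam0 _) (fun i => hb0 _) (V y0) (hVpos _).le
        h1 h3 h2
      obtain ⟨N, hN⟩ := exists_nat_ge c
      exact ⟨N, fun n => (hc n).trans hN⟩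
    have hbdm : MeasurableSet {x : ℤ → F | ∃ c : ℕ, ∀ n, u n x ≤ c} := by
      have : {x : ℤ → F | ∃ c : ℕ, ∀ n, u n x ≤ c} = ⋃ c : ℕ, ⋂ n, {x | u n x ≤ c} := by
        ext x; simp
      rw [this]
      exact MeasurableSet.iUnion fun c => MeasurableSet.iInter fun n =>
        measurableSet_le (hum n) measurable_const
    have hbd' : ∀ᵐ x ∂Q, ∃ c : ℕ, ∀ n, u n x ≤ c :=
      (ae_map_iff hXm.aemeasurable hbdm).2 hbd
    obtain ⟨p, hp, hpQ, hpi⟩ := exists_invariant (shiftEquiv F) Q (hsb 1) (liftP P) W hWm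
      (fun x => ENNReal.ofReal (lam (x 0))) (fun x => ENNReal.ofReal (b (x 0)))
      (hlam.comp (measurable_pi_apply 0)).ennreal_ofReal
      (hb.comp (measurable_pi_apply 0)).ennreal_ofReal
      (fun x y => hdrift (x 0) y) y0 (fun n x => ENNReal.ofReal (u n x))
      (fun n => (hum n).ennreal_ofReal) (fun x => by simp [hu, hW]) (by
        intro n x
        have e1 : u (n + 1) (shiftBy 1 x) = lam (x 0) * u n x + b (x 0) := by
          have := drift_rec (fun i => lam (x (-(i : ℤ)))) (fun i => b (x (-(i : ℤ)))) (V y0) n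
          have e2 : ∀ i : ℕ, shiftBy 1 x (-(i : ℤ) - 1) = x (-(i : ℤ)) := fun i => by
            simp [shiftBy]
          have e3 : ∀ i : ℕ, x (-((i + 1 : ℕ) : ℤ)) = x (-(i : ℤ) - 1) := fun i => by
            congr 1; push_cast; ring
          simp only [e3] at this
          simp only [hu, e2]
          simpa using this
        change ENNReal.ofReal (u (n + 1) (shiftBy 1 x)) = _
        rw [e1, ENNReal.ofReal_add (mul_nonneg (hlam0 _) (hu0 _ _)) (hb0 _),
          ENNReal.ofReal_mul (hlam0 _)])
      (by
        filter_upwards [hbd'] with x hx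
        obtain ⟨c, hc⟩ := hx
        refine ⟨c, fun n => ?_⟩
        rw [← ENNReal.ofReal_natCast]
        exact ENNReal.ofReal_le_ofReal (hc n)) hsmall'
    exact exists_solution P Q p hpQ hpi
  · rintro μ₁ μ₂ ⟨i1, s1, m1, k1⟩ ⟨i2, s2, m2, k2⟩
    refine mcre_unique P μ₁ μ₂ s1 k1 s2 k2 ?_
    have := Measure.isProbabilityMeasure_map (μ := μ₁)
      (measurable_pairMap (E := E) (F := F)).aemeasurable
    have := Measure.isProbabilityMeasure_map (μ := μ₂)
      (measurable_pairMap (E := E) (F := F)).aemeasurable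
    refine invariant_unique (shiftEquiv F) (liftP P) W hWm (fun y => ENNReal.ofReal_ne_top)
      hsmall' _ _ (pair_invariant P μ₁ s1 k1) (pair_invariant P μ₂ s2 k2) ?_
    rw [Measure.map_map measurable_fst measurable_pairMap,
      Measure.map_map measurable_fst measurable_pairMap]
    exact m1.trans m2.symm

end
end

section
/- Suppose Assumptions A1–A3 hold and that in addition the process (X_t)_{t∈ℤ} is ergodic (its law on F^ℤ is ergodic for the shift). Then the unique stationary process ((Y_t, X_t))_{t∈ℤ} satisfying the model equation ℙ(Y_t ∈ A | X, Y_{t-1}, Y_{t-2}, …) = P_{X_{t-1}}(Y_{t-1}, A) a.s. is ergodic, i.e., its law on (E×F)^ℤ is ergodic for the shift. -/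
open MeasureTheory ProbabilityTheory Filter
open scoped ENNReal

noncomputable section

section Helpers

variable {E F : Type*} [MeasurableSpace E] [MeasurableSpace F]

/-- The environment together with the chain restricted to the time set `S`. -/
def pre (S : Set ℤ) (z : ℤ → E × F) : (ℤ → F) × (S → E) :=
  (fun s => (z s).2, fun s => (z s.1).1)

lemma measurable_pre (S : Set ℤ) : Measurable (pre S : (ℤ → E × F) → _) := by
  unfold pre
  fun_prop

/-- σ-algebra generated by the environment and the chain on `S`. -/
def gS (E F : Type*) [MeasurableSpace E] [MeasurableSpace F] (S : Set ℤ) :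
    MeasurableSpace (ℤ → E × F) :=
  MeasurableSpace.comap (pre S) inferInstance

lemma gS_le (S : Set ℤ) : gS E F S ≤ MeasurableSpace.pi := (measurable_pre S).comap_le

lemma histSigma_eq_s1 (t : ℤ) : histSigma E F t = gS E F (Set.Iio t) := rfl

lemma gS_mono {S T : Set ℤ} (h : S ⊆ T) : gS E F S ≤ gS E F T := by
  have : (pre S : (ℤ → E × F) → _) =
    (fun p : (ℤ → F) × (T → E) => (p.1, fun s : S => p.2 ⟨s.1, h s.2⟩)) ∘ pre T := rfl
  unfold gS
  rw [this, ← MeasurableSpace.comap_comp]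
  refine MeasurableSpace.comap_mono (Measurable.comap_le ?_)
  fun_prop

/-- Two-sided shift by `k`. -/
def sh {α : Type*} (k : ℤ) (x : ℤ → α) : ℤ → α := fun t => x (t + k)

lemma measurable_sh {α : Type*} [MeasurableSpace α] (k : ℤ) :
    Measurable (sh k : (ℤ → α) → _) := by
  unfold sh
  fun_prop

lemma measurable_sh_gS (S T : Set ℤ) (k : ℤ) (h : ∀ s ∈ S, s + k ∈ T) :
    Measurable[gS E F T, gS E F S] (sh k) := by
  rw [measurable_iff_comap_le]
  unfold gS
  rw [MeasurableSpace.comap_comp]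
  have : (pre S : (ℤ → E × F) → _) ∘ sh k =
    (fun p : (ℤ → F) × (T → E) => (fun t => p.1 (t + k), fun s : S => p.2 ⟨s.1 + k, h _ s.2⟩)) ∘
      pre T := rfl
  rw [this, ← MeasurableSpace.comap_comp]
  refine MeasurableSpace.comap_mono (Measurable.comap_le ?_)
  fun_prop

lemma map_sh {α : Type*} [MeasurableSpace α] (μ : Measure (ℤ → α)) (h : μ.map zshift = μ) (k : ℤ) :
    MeasurePreserving (sh k) μ μ := by
  have h1 : ∀ n : ℕ, μ.map (sh (n : ℤ)) = μ := by
    intro n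
    induction n with
    | zero =>
      have : (sh ((0 : ℕ) : ℤ) : (ℤ → α) → _) = id := by ext; simp [sh]
      rw [this, Measure.map_id]
    | succ n ih =>
      have : (sh ((n + 1 : ℕ) : ℤ) : (ℤ → α) → _) = sh (n : ℤ) ∘ zshift := by
        funext x t
        simp only [sh, zshift, Function.comp]
        congr 1
        push_cast; ring
      rw [this, ← Measure.map_map (measurable_sh _) (show Measurable zshift from measurable_sh 1), h, ih]
  refine ⟨measurable_sh k, ?_⟩
  obtain ⟨n, rfl | rfl⟩ := k.eq_nat_or_neg
  · exact h1 n
  · conv_lhs => rw [← h1 n]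
    rw [Measure.map_map (measurable_sh _) (measurable_sh _)]
    have : (sh (-(n : ℤ)) ∘ sh (n : ℤ) : (ℤ → α) → _) = id := by
      ext; simp [sh]
    rw [this, Measure.map_id]

/-- The transition kernel from the history. -/
def KS (P : Kernel (F × E) E) (S : Set ℤ) (t : ℤ) (h : t - 1 ∈ S) :
    Kernel ((ℤ → F) × (S → E)) E :=
  P.comap (fun p => (p.1 (t - 1), p.2 ⟨t - 1, h⟩)) (by fun_prop)

instance (P : Kernel (F × E) E) [IsMarkovKernel P] (S : Set ℤ) (t : ℤ) (h : t - 1 ∈ S) :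
    IsMarkovKernel (KS P S t h) := by unfold KS; infer_instance

lemma map_eq_compProd (P : Kernel (F × E) E) [IsMarkovKernel P] (μ : Measure (ℤ → E × F))
    [IsProbabilityMeasure μ] (hsol : IsMCRESolution P μ) (t : ℤ) {β : Type*} [MeasurableSpace β]
    (q : (ℤ → E × F) → β) (hq : Measurable[gS E F (Set.Iio t)] q)
    (K : Kernel β E) [IsMarkovKernel K] (hK : ∀ z, K (q z) = P ((z (t - 1)).2, (z (t - 1)).1)) :
    μ.map (fun z => (q z, (z t).1)) = μ.map q ⊗ₘ K := by
  have hq' : Measurable q := hq.mono (gS_le _) le_rfl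
  have hm : Measurable (fun z : ℤ → E × F => (q z, (z t).1)) :=
    hq'.prodMk (by fun_prop)
  have : IsProbabilityMeasure (μ.map (fun z => (q z, (z t).1))) :=
    Measure.isProbabilityMeasure_map hm.aemeasurable
  have : IsProbabilityMeasure (μ.map q) :=
    Measure.isProbabilityMeasure_map hq'.aemeasurable
  refine Measure.ext_prod ?_
  intro B A hB hA
  rw [Measure.map_apply hm (hB.prod hA), Measure.compProd_apply_prod hB hA,
    setLIntegral_map hB (Kernel.measurable_coe _ hA) hq']
  have hBm : MeasurableSet[histSigma E F t] (q ⁻¹' B) := hq hB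
  have hAm : MeasurableSet {z : ℤ → E × F | (z t).1 ∈ A} :=
    (show Measurable fun z : ℤ → E × F => (z t).1 by fun_prop) hA
  have hle : histSigma E F t ≤ MeasurableSpace.pi := gS_le _
  have key := setIntegral_condExp (μ := μ) hle
    (f := ({z : ℤ → E × F | (z t).1 ∈ A}).indicator (fun _ => (1 : ℝ)))
    ((integrable_const 1).indicator hAm) hBm
  rw [setIntegral_congr_ae (g := fun z => (P ((z (t - 1)).2, (z (t - 1)).1) A).toReal)
    (hle _ hBm) ((hsol t A hA).mono fun z hz _ => hz)] at key
  rw [integral_toReal, integral_indicator hAm] at key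
  · simp only [integral_const, MeasurableSet.univ, measureReal_restrict_apply, Set.univ_inter,
      smul_eq_mul, mul_one] at key
    rw [measureReal_def, Measure.restrict_apply hAm] at key
    rw [ENNReal.toReal_eq_toReal_iff'] at key
    · rw [show (fun z : ℤ → E × F => (q z, (z t).1)) ⁻¹' (B ×ˢ A) =
        {z : ℤ → E × F | (z t).1 ∈ A} ∩ q ⁻¹' B by ext; simp [and_comm]]
      rw [← key]
      simp only [hK]
    · refine ne_top_of_le_ne_top (b := ∫⁻ z in q ⁻¹' B, 1 ∂μ) (by simp) ?_
      exact lintegral_mono fun z => prob_le_one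
    · finiteness
  · have := Kernel.measurable_coe P hA
    exact (by fun_prop : Measurable fun z : ℤ → E × F =>
      P ((z (t - 1)).2, (z (t - 1)).1) A).aemeasurable
  · exact ae_of_all _ fun z => by finiteness

/-- mergeAt a path on `S` with a value at time `t`. -/
def mergeAt (S : Set ℤ) (t : ℤ) (v : S → E) (y : E) : ↥(insert t S : Set ℤ) → E :=
  fun s => if h : s.1 = t then y else v ⟨s.1, by
    have := s.2
    simp only [Set.mem_insert_iff] at this
    tauto⟩

lemma measurable_mergeAt (S : Set ℤ) (t : ℤ) :
    Measurable (fun p : (S → E) × E => mergeAt S t p.1 p.2) := by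
  refine measurable_pi_lambda _ fun s => ?_
  unfold mergeAt
  by_cases h : s.1 = t
  · simp only [h, dite_true]; fun_prop
  · simp only [h, dite_false]; fun_prop

lemma onestep [StandardBorelSpace E] (P : Kernel (F × E) E) [IsMarkovKernel P]
    (μ : Measure (ℤ → E × F))
    [IsProbabilityMeasure μ] (hsol : IsMCRESolution P μ) (t : ℤ) (S : Set ℤ)
    (hS : S ⊆ Set.Iio t) (h : t - 1 ∈ S) (W : (ℤ → E × F) → ℝ) (hW : Integrable W μ)
    (hWm : StronglyMeasurable[gS E F (insert t S)] W) :
    AEStronglyMeasurable[gS E F S] (μ[W | gS E F (Set.Iio t)]) μ := by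
  obtain ⟨w, hw, rfl⟩ := hWm.measurable.exists_eq_measurable_comp
  have : Nonempty E := by
    obtain ⟨z⟩ := μ.nonempty_of_neZero
    exact ⟨(z 0).1⟩
  have hlt : t - 1 ∈ Set.Iio t := by simp
  let f : ((ℤ → F) × (S → E)) × E → ℝ := fun p => w (p.1.1, mergeAt S t p.1.2 p.2)
  have hf : Measurable f := by
    have := measurable_mergeAt (E := E) S t
    have h2 : Measurable fun p : ((ℤ → F) × (S → E)) × E => mergeAt S t p.1.2 p.2 :=
      this.comp (by fun_prop : Measurable fun p : ((ℤ → F) × (S → E)) × E => (p.1.2, p.2))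
    exact hw.comp (by fun_prop)
  let r : (ℤ → F) × (Set.Iio t → E) → (ℤ → F) × (S → E) :=
    fun p => (p.1, fun s => p.2 ⟨s.1, hS s.2⟩)
  have hr : Measurable r := by fun_prop
  have hWf : w ∘ pre (insert t S) = fun z : ℤ → E × F => f (r (pre (Set.Iio t) z), (z t).1) := by
    funext z
    simp only [Function.comp, f, r, pre]
    congr 2
    funext s
    unfold mergeAt
    split_ifs with h
    · rw [h]
    · rfl
  have hY : Measurable fun z : ℤ → E × F => (z t).1 := by fun_prop
  have e1 := condExp_prod_ae_eq_integral_condDistrib (μ := μ) (measurable_pre (Set.Iio t))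
    hY.aemeasurable (f := fun p => f (r p.1, p.2))
    (by have : Measurable fun p : ((ℤ → F) × (Set.Iio t → E)) × E => f (r p.1, p.2) := by fun_prop
        exact this.stronglyMeasurable) (by rw [hWf] at hW; exact hW)
  have e2 := condDistrib_ae_eq_of_measure_eq_compProd (pre (Set.Iio t)) hY.aemeasurable
    (map_eq_compProd P μ hsol t (pre (Set.Iio t)) (comap_measurable _) (KS P (Set.Iio t) t hlt)
      fun z => rfl)
  have e3 := ae_of_ae_map (measurable_pre (Set.Iio t)).aemeasurable e2
  refine ⟨fun z => ∫ y, f (pre S z, y) ∂(KS P S t h (pre S z)), ?_, ?_⟩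
  · have : StronglyMeasurable fun p => ∫ y, f (p, y) ∂(KS P S t h p) :=
      hf.stronglyMeasurable.integral_kernel_prod_right'
    exact this.comp_measurable (comap_measurable _)
  · rw [hWf]
    refine EventuallyEq.trans e1 ?_
    filter_upwards [e3] with z hz
    rw [hz]
    rfl

lemma markov [StandardBorelSpace E] (P : Kernel (F × E) E) [IsMarkovKernel P]
    (μ : Measure (ℤ → E × F))
    [IsProbabilityMeasure μ] (hsol : IsMCRESolution P μ) (a : ℤ) (m : ℕ) :
    ∀ W : (ℤ → E × F) → ℝ, Integrable W μ →
    StronglyMeasurable[gS E F (Set.Icc a (a + m))] W →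
    AEStronglyMeasurable[gS E F {a}] (μ[W | gS E F (Set.Iic a)]) μ := by
  induction m with
  | zero =>
    intro W hW hWm
    have h0 : Set.Icc a (a + ((0 : ℕ) : ℤ)) = {a} := by simp
    rw [h0] at hWm
    rw [condExp_of_stronglyMeasurable (gS_le _)
      (hWm.mono (gS_mono (by simp))) hW]
    exact hWm.aestronglyMeasurable
  | succ m ih =>
    intro W hW hWm
    have h1 : (Set.Icc a (a + ((m + 1 : ℕ) : ℤ))) = insert (a + m + 1) (Set.Icc a (a + m)) := by
      ext; simp only [Set.mem_Icc, Set.mem_insert_iff]; push_cast; omega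
    rw [h1] at hWm
    have h2 := onestep P μ hsol (a + m + 1) (Set.Icc a (a + m))
      (by intro s; simp only [Set.mem_Icc, Set.mem_Iio]; omega)
      (by simp only [Set.mem_Icc]; omega) W hW hWm
    have h3 : gS E F (Set.Iic a) ≤ gS E F (Set.Iio (a + m + 1)) :=
      gS_mono (by intro s; simp only [Set.mem_Iic, Set.mem_Iio]; omega)
    have h4 := condExp_condExp_of_le (μ := μ) (f := W) h3 (gS_le _)
    have h5 := condExp_congr_ae (m := gS E F (Set.Iic a)) h2.ae_eq_mk
    refine (ih (h2.mk _) (integrable_condExp.congr h2.ae_eq_mk) h2.stronglyMeasurable_mk).congr ?_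
    exact h5.symm.trans h4

lemma condExp_eq_of_approx {Ω : Type*} {m m0 : MeasurableSpace Ω} (hm : m ≤ m0) (μ : Measure Ω)
    [IsProbabilityMeasure μ] (f : Ω → ℝ) (hf : Integrable f μ)
    (H : ∀ ε : ℝ≥0∞, 0 < ε → ∃ d : Ω → ℝ, Integrable d μ ∧ AEStronglyMeasurable[m] d μ ∧
      eLpNorm (d - f) 1 μ ≤ ε) : μ[f | m] =ᵐ[μ] f := by
  have h0 : eLpNorm (μ[f | m] - f) 1 μ = 0 := by
    by_contra hne
    have hpos : 0 < eLpNorm (μ[f | m] - f) 1 μ := pos_iff_ne_zero.2 hne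
    obtain ⟨ε, hε, hlt⟩ : ∃ ε : ℝ≥0∞, 0 < ε ∧ ε + ε < eLpNorm (μ[f | m] - f) 1 μ := by
      obtain ⟨c, hc0, hc⟩ := exists_between hpos
      exact ⟨c / 2, ENNReal.div_pos hc0.ne' (by simp), by rwa [ENNReal.add_halves]⟩
    obtain ⟨d, hd, hdm, hdε⟩ := H ε hε
    refine absurd hlt (not_lt.2 ?_)
    have e1 : μ[f | m] - f =ᵐ[μ] μ[f - d | m] + (d - f) := by
      filter_upwards [condExp_sub hf hd m, condExp_of_aestronglyMeasurable' hm hdm hd] with z h1 h2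
      simp only [Pi.sub_apply, Pi.add_apply] at *
      rw [h1, h2]; ring
    rw [eLpNorm_congr_ae e1]
    refine (eLpNorm_add_le integrable_condExp.aestronglyMeasurable
      (hd.sub hf).aestronglyMeasurable le_rfl).trans (add_le_add ?_ hdε)
    refine (eLpNorm_condExp_le_eLpNorm _ le_rfl).trans ?_
    rwa [eLpNorm_sub_comm]
  rw [eLpNorm_eq_zero_iff (integrable_condExp.sub hf).aestronglyMeasurable one_ne_zero] at h0
  filter_upwards [h0] with z hz
  simpa [sub_eq_zero] using hz

/-- windows filtration -/
def winFil (E F : Type*) [MeasurableSpace E] [MeasurableSpace F] :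
    Filtration ℕ (MeasurableSpace.pi : MeasurableSpace (ℤ → E × F)) where
  seq n := gS E F (Set.Icc (-(n : ℤ)) n)
  mono' i j hij := gS_mono (Set.Icc_subset_Icc (by omega) (by omega))
  le' n := gS_le _

lemma iSup_winFil : (MeasurableSpace.pi : MeasurableSpace (ℤ → E × F)) ≤ ⨆ n, winFil E F n := by
  refine iSup_le fun t => ?_
  refine le_trans ?_ (le_iSup (fun n => (winFil E F n : MeasurableSpace _)) t.natAbs)
  have ht : t ∈ Set.Icc (-(t.natAbs : ℤ)) t.natAbs := by
    simp only [Set.mem_Icc]; omega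
  change MeasurableSpace.comap _ _ ≤ MeasurableSpace.comap _ _
  have : (fun z : ℤ → E × F => z t) =
    (fun p : (ℤ → F) × (Set.Icc (-(t.natAbs : ℤ)) t.natAbs → E) => (p.2 ⟨t, ht⟩, p.1 t)) ∘
      pre _ := rfl
  rw [this, ← MeasurableSpace.comap_comp]
  refine MeasurableSpace.comap_mono (Measurable.comap_le ?_)
  fun_prop

lemma approx (μ : Measure (ℤ → E × F)) [IsProbabilityMeasure μ] (f : (ℤ → E × F) → ℝ)
    (hf : Integrable f μ) (hfm : Measurable f) (ε : ℝ≥0∞) (hε : 0 < ε) :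
    ∃ (n : ℕ) (c : (ℤ → E × F) → ℝ), Integrable c μ ∧
      StronglyMeasurable[gS E F (Set.Icc (-(n : ℤ)) n)] c ∧ eLpNorm (c - f) 1 μ ≤ ε := by
  have h := hf.tendsto_eLpNorm_condExp (ℱ := winFil E F)
    (hfm.stronglyMeasurable.mono iSup_winFil)
  obtain ⟨n, hn⟩ := (h.eventually (gt_mem_nhds hε)).exists
  exact ⟨n, _, integrable_condExp, stronglyMeasurable_condExp, hn.le⟩

lemma invariant_present [StandardBorelSpace E] (P : Kernel (F × E) E) [IsMarkovKernel P]
    (μ : Measure (ℤ → E × F)) [IsProbabilityMeasure μ] (hstat : μ.map zshift = μ)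
    (hsol : IsMCRESolution P μ) (f : (ℤ → E × F) → ℝ)
    (hf : Integrable f μ) (hfm : Measurable f) (hinv : ∀ k, f ∘ sh k = f) :
    μ[f | gS E F {0}] =ᵐ[μ] f := by
  have happ : ∀ (ε : ℝ≥0∞), 0 < ε → ∃ n : ℕ, ∀ k : ℤ, ∃ c : (ℤ → E × F) → ℝ, Integrable c μ ∧
      StronglyMeasurable[gS E F (Set.Icc (k - (n : ℤ)) (k + n))] c ∧ eLpNorm (c - f) 1 μ ≤ ε := by
    intro ε hε
    obtain ⟨n, c, hc, hcm, hcε⟩ := approx μ f hf hfm ε hε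
    refine ⟨n, fun k => ⟨c ∘ sh k, (map_sh μ hstat k).integrable_comp_of_integrable hc, ?_, ?_⟩⟩
    · refine hcm.comp_measurable (measurable_sh_gS _ _ k ?_)
      intro s; simp only [Set.mem_Icc]; omega
    · have : c ∘ sh k - f = (c - f) ∘ sh k := by
        conv_lhs => rw [← hinv k]
        rfl
      rwa [this, eLpNorm_comp_measurePreserving (hc.sub hf).aestronglyMeasurable
        (map_sh μ hstat k)]
  have hpast : μ[f | gS E F (Set.Iic 0)] =ᵐ[μ] f := by
    refine condExp_eq_of_approx (gS_le _) μ f hf fun ε hε => ?_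
    obtain ⟨n, hn⟩ := happ ε hε
    obtain ⟨c, hc, hcm, hcε⟩ := hn (-n)
    refine ⟨c, hc, (hcm.mono (gS_mono ?_)).aestronglyMeasurable, hcε⟩
    intro s; simp only [Set.mem_Icc, Set.mem_Iic]; omega
  refine condExp_eq_of_approx (gS_le _) μ f hf fun ε hε => ?_
  obtain ⟨n, hn⟩ := happ ε hε
  obtain ⟨c, hc, hcm, hcε⟩ := hn n
  refine ⟨μ[c | gS E F (Set.Iic 0)], integrable_condExp,
    markov P μ hsol 0 (2 * n) c hc (hcm.mono (gS_mono ?_)), ?_⟩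
  · intro s; simp only [Set.mem_Icc]; push_cast; omega
  · have e : μ[c | gS E F (Set.Iic 0)] - f =ᵐ[μ] μ[c - f | gS E F (Set.Iic 0)] := by
      filter_upwards [hpast, condExp_sub hc hf (gS E F (Set.Iic 0))] with z h1 h2
      rw [h2]; simp [h1]
    rw [eLpNorm_congr_ae e]
    exact (eLpNorm_condExp_le_eLpNorm _ le_rfl).trans hcε

end Helpers

lemma quasi_zshift {α : Type*} [MeasurableSpace α] (μ : Measure (ℤ → α))
    (h : μ.map zshift = μ) : Measure.QuasiMeasurePreserving zshift μ μ :=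
  (map_sh μ h 1).quasiMeasurePreserving

lemma invariant_set_present {E F : Type*} [MeasurableSpace E] [MeasurableSpace F]
    [StandardBorelSpace E] (P : Kernel (F × E) E) [IsMarkovKernel P]
    (μ : Measure (ℤ → E × F)) [IsProbabilityMeasure μ] (hstat : μ.map zshift = μ)
    (hsol : IsMCRESolution P μ) (A : Set (ℤ → E × F)) (hA : MeasurableSet A)
    (hinv : zshift ⁻¹' A = A) :
    ∃ B : Set ((ℤ → F) × E), MeasurableSet B ∧
      ∀ᵐ z ∂μ, (z ∈ A ↔ (fun t => (z t).2, (z 0).1) ∈ B) := by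
  have hmem : ∀ z, zshift z ∈ A ↔ z ∈ A := fun z => by rw [← Set.mem_preimage, hinv]
  have hn : ∀ (n : ℕ) z, sh (n : ℤ) z ∈ A ↔ z ∈ A := by
    intro n
    induction n with
    | zero =>
      intro z
      have : sh ((0 : ℕ) : ℤ) z = z := by funext t; simp [sh]
      rw [this]
    | succ n ih =>
      intro z
      rw [← ih z, ← hmem (sh (n : ℤ) z)]
      have : sh ((n + 1 : ℕ) : ℤ) z = zshift (sh (n : ℤ) z) := by
        funext t
        simp only [sh, zshift]
        congr 1
        push_cast; ring
      rw [this]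
  have hk : ∀ (k : ℤ) z, sh k z ∈ A ↔ z ∈ A := by
    intro k z
    obtain ⟨n, rfl | rfl⟩ := k.eq_nat_or_neg
    · exact hn n z
    · rw [← hn n (sh (-(n : ℤ)) z)]
      have : sh (n : ℤ) (sh (-(n : ℤ)) z) = z := by funext t; simp [sh]
      rw [this]
  have h := invariant_present P μ hstat hsol (A.indicator fun _ => (1 : ℝ))
    ((integrable_const 1).indicator hA) (measurable_const.indicator hA) (by
      intro k
      funext z
      by_cases hz : z ∈ A
      · rw [Function.comp, Set.indicator_of_mem ((hk k z).2 hz), Set.indicator_of_mem hz]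
      · rw [Function.comp, Set.indicator_of_notMem (fun h => hz ((hk k z).1 h)),
          Set.indicator_of_notMem hz])
  obtain ⟨γ, hγ, hγe⟩ :=
    (stronglyMeasurable_condExp (m := gS E F {0}) (μ := μ)
      (f := A.indicator fun _ => (1 : ℝ))).measurable.exists_eq_measurable_comp
  refine ⟨(fun p : (ℤ → F) × E => γ (p.1, fun _ => p.2)) ⁻¹' {1}, ?_, ?_⟩
  · exact (hγ.comp (by fun_prop)) (measurableSet_singleton 1)
  · filter_upwards [h] with z hz
    rw [hγe] at hz
    have e : pre {0} z = (fun t => (z t).2, fun _ => (z 0).1) := by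
      unfold pre
      congr 1
      funext s
      rw [s.2]
    simp only [Function.comp, e] at hz
    simp only [Set.mem_preimage, Set.mem_singleton_iff, hz]
    by_cases hzA : z ∈ A <;> simp [hzA]

theorem ergodicity_stationary_MCRE
    {E F : Type*}
    [MeasurableSpace E] [TopologicalSpace E] [PolishSpace E] [BorelSpace E]
    [MeasurableSpace F] [TopologicalSpace F] [PolishSpace F] [BorelSpace F]
    {Ω : Type*} [MeasurableSpace Ω] (Pr : Measure Ω) [IsProbabilityMeasure Pr]
    (X : ℤ → Ω → F) (hX : ∀ t, Measurable (X t))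
    (P : Kernel (F × E) E) [IsMarkovKernel P]
    -- A1 : the environment is stationary
    (hstat : (Pr.map fun ω => fun t => X t ω).map zshift = Pr.map fun ω => fun t => X t ω)
    -- the environment is moreover ergodic
    (herg : Ergodic zshift (Pr.map fun ω => fun t => X t ω))
    -- A2 : drift condition with random coefficients
    (V : E → ℝ) (hVmeas : Measurable V) (hVpos : ∀ y, 0 < V y)
    (lam b : F → ℝ) (hlam : Measurable lam) (hb : Measurable b)
    (hlam0 : ∀ x, 0 ≤ lam x) (hb0 : ∀ x, 0 ≤ b x)
    (hlamlog : ∫⁻ ω, ENNReal.ofReal (Real.log (max (lam (X 0 ω)) 1)) ∂Pr < ∞)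
    (hblog : ∫⁻ ω, ENNReal.ofReal (Real.log (max (b (X 0 ω)) 1)) ∂Pr < ∞)
    (hdrift : ∀ (x : F) (y : E), ∫⁻ z, ENNReal.ofReal (V z) ∂(P (x, y)) ≤
      ENNReal.ofReal (lam x) * ENNReal.ofReal (V y) + ENNReal.ofReal (b x))
    (hlyap : ∀ᵐ ω ∂Pr, atTop.limsup
      (fun n : ℕ => (∏ i ∈ Finset.range n, lam (X (-(i : ℤ) - 1) ω)) ^ ((n : ℝ)⁻¹)) < 1)
    -- A3 : sublevel sets of V are small sets, uniformly in the environment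
    (η : ℝ → F → ℝ) (hηmeas : Measurable fun p : ℝ × F => η p.1 p.2)
    (hη01 : ∀ R > (0 : ℝ), ∀ x, η R x ∈ Set.Ioo (0 : ℝ) 1)
    (hsmall : ∀ R > (0 : ℝ), ∃ ν : Kernel F E, IsMarkovKernel ν ∧
      ∀ (x : F) (y : E) (A : Set E), MeasurableSet A → V y ≤ R →
        ENNReal.ofReal (η R x) * ν x A ≤ P (x, y) A) :
    -- any stationary solution with environment distributed as X is ergodic
    ∀ μ : Measure (ℤ → E × F), IsProbabilityMeasure μ →
      μ.map zshift = μ →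
      μ.map (fun z => fun t => (z t).2) = Pr.map (fun ω => fun t => X t ω) →
      IsMCRESolution P μ →
      Ergodic zshift μ := by
  intro μ hμ hμstat hμX hsol
  have hTm : Measurable (zshift : (ℤ → E × F) → _) := measurable_sh 1
  refine ⟨⟨hTm, hμstat⟩, ⟨?_⟩⟩
  intro A hA hAinv
  have : Nonempty E := by
    obtain ⟨z⟩ := μ.nonempty_of_neZero
    exact ⟨(z 0).1⟩
  obtain ⟨B, hB, hAB⟩ := invariant_set_present P μ hμstat hsol A hA hAinv
  have hqp := quasi_zshift μ hμstat
  -- the present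
  let q : (ℤ → E × F) → (ℤ → F) × E := fun z => (fun t => (z t).2, (z 0).1)
  have hq : Measurable q := by fun_prop
  let K : Kernel ((ℤ → F) × E) E := P.comap (fun p => (p.1 0, p.2)) (by fun_prop)
  have hK : IsMarkovKernel K := by infer_instance
  let m := μ.map q
  have hm : IsProbabilityMeasure m := Measure.isProbabilityMeasure_map hq.aemeasurable
  have hlaw : μ.map (fun z => (q z, (z 1).1)) = m ⊗ₘ K := by
    refine map_eq_compProd P μ hsol 1 q ?_ K fun z => rfl
    exact (by fun_prop : Measurable fun p : (ℤ → F) × (Set.Iio (1 : ℤ) → E) =>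
      (p.1, p.2 ⟨0, by simp⟩)).comp (comap_measurable (pre (Set.Iio (1 : ℤ))))
  have hzs : Measurable (zshift : (ℤ → F) → _) := measurable_sh 1
  have hstep : ∀ᵐ z ∂μ, (q z ∈ B ↔ ((zshift (q z).1, (z 1).1) : (ℤ → F) × E) ∈ B) := by
    filter_upwards [hAB, hqp.ae hAB] with z h1 h2
    rw [← h1]
    have : zshift z ∈ A ↔ z ∈ A := by rw [← Set.mem_preimage, hAinv]
    rw [← this, h2]
    rfl
  have hstepK : ∀ᵐ p ∂(m ⊗ₘ K), (p.1 ∈ B ↔ ((zshift p.1.1, p.2) : (ℤ → F) × E) ∈ B) := by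
    rw [← hlaw, ae_map_iff (by fun_prop)]
    · exact hstep
    · have e1 : Measurable fun p : ((ℤ → F) × E) × E => p.1 := by fun_prop
      have e2 : Measurable fun p : ((ℤ → F) × E) × E => (zshift p.1.1, p.2) := by fun_prop
      exact (e1 hB).iff (e2 hB)
  have h3 := Measure.ae_ae_of_ae_compProd hstepK
  rw [← m.disintegrate m.condKernel] at h3
  have h4 := Measure.ae_ae_of_ae_compProd h3
  -- dichotomy on the fibres
  have hdich : ∀ᵐ x ∂m.fst, m.condKernel x {y | (x, y) ∈ B} = 0 ∨
      m.condKernel x {y | (x, y) ∉ B} = 0 := by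
    filter_upwards [h4] with x hx
    by_contra hcon
    push Not at hcon
    obtain ⟨hc1, hc2⟩ := hcon
    obtain ⟨y, hyB, hy⟩ := ((frequently_ae_mem_iff.2 hc1).and_eventually hx).exists
    obtain ⟨y', hyB', hy'⟩ := ((frequently_ae_mem_iff.2 hc2).and_eventually hx).exists
    have hR : 0 < max (V y) (V y') := lt_max_of_lt_left (hVpos y)
    obtain ⟨ν, hν, hmin⟩ := hsmall _ hR
    have hη : ENNReal.ofReal (η (max (V y) (V y')) (x 0)) ≠ 0 := by
      simpa using (hη01 _ hR (x 0)).1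
    have hCm : MeasurableSet {w : E | ((zshift x, w) : (ℤ → F) × E) ∈ B} :=
      measurable_prodMk_left hB
    have n1 : P (x 0, y) {w : E | ((zshift x, w) : (ℤ → F) × E) ∈ B}ᶜ = 0 := by
      change ∀ᵐ w ∂(P (x 0, y)), ((zshift x, w) : (ℤ → F) × E) ∈ B
      change ∀ᵐ w ∂(P (x 0, y)), _ at hy
      filter_upwards [hy] with w hw using hw.1 hyB
    have n2 : P (x 0, y') {w : E | ((zshift x, w) : (ℤ → F) × E) ∈ B} = 0 := by
      rw [← compl_compl {w : E | ((zshift x, w) : (ℤ → F) × E) ∈ B}]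
      change ∀ᵐ w ∂(P (x 0, y')), ((zshift x, w) : (ℤ → F) × E) ∉ B
      change ∀ᵐ w ∂(P (x 0, y')), _ at hy'
      filter_upwards [hy'] with w hw using fun hh => hyB' (hw.2 hh)
    have k1 := hmin (x 0) y _ hCm.compl (le_max_left _ _)
    have k2 := hmin (x 0) y' _ hCm (le_max_right _ _)
    rw [n1, nonpos_iff_eq_zero, mul_eq_zero, or_iff_right hη] at k1
    rw [n2, nonpos_iff_eq_zero, mul_eq_zero, or_iff_right hη] at k2
    have k3 := prob_add_prob_compl (μ := ν (x 0)) hCm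
    rw [k1, k2] at k3
    simp at k3
  let D : Set (ℤ → F) := {x | m.condKernel x {y | (x, y) ∉ B} = 0}
  have hD : MeasurableSet D :=
    (Kernel.measurable_kernel_prodMk_left (κ := m.condKernel) hB.compl) (measurableSet_singleton 0)
  have hBD : ∀ᵐ p ∂m, (p ∈ B ↔ p.1 ∈ D) := by
    rw [← m.disintegrate m.condKernel]
    refine Measure.ae_compProd_of_ae_ae (hB.iff (measurable_fst hD)) ?_
    filter_upwards [hdich] with x hx
    by_cases hxD : x ∈ D
    · have : ∀ᵐ y ∂m.condKernel x, (x, y) ∈ B := hxD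
      filter_upwards [this] with y hy
      exact iff_of_true hy hxD
    · have h0 := hx.resolve_right hxD
      filter_upwards [measure_eq_zero_iff_ae_notMem.1 h0] with y hy
      exact iff_of_false hy hxD
  have hAD : ∀ᵐ z ∂μ, (z ∈ A ↔ (fun t => (z t).2) ∈ D) := by
    filter_upwards [hAB, ae_of_ae_map hq.aemeasurable hBD] with z h1 h2
    exact h1.trans h2
  -- ergodicity of the environment
  rw [← hμX] at herg
  have hpX : Measurable (fun z : ℤ → E × F => fun t => (z t).2) := by fun_prop
  have hDinv : (zshift ⁻¹' D : Set (ℤ → F)) =ᵐ[μ.map fun z t => (z t).2] D := by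
    rw [eventuallyEq_set]
    refine (ae_map_iff (p := fun x => x ∈ zshift ⁻¹' D ↔ x ∈ D) hpX.aemeasurable
      (MeasurableSet.iff (hzs hD) hD)).2 ?_
    filter_upwards [hAD, hqp.ae hAD] with z h1 h2
    have : zshift z ∈ A ↔ z ∈ A := by rw [← Set.mem_preimage, hAinv]
    rw [← h1, ← this, h2]
    rfl
  rw [eventuallyConst_set']
  rcases herg.quasiErgodic.ae_empty_or_univ₀ hD.nullMeasurableSet hDinv with h | h
  · left
    rw [eventuallyEq_set] at h ⊢
    filter_upwards [hAD, ae_of_ae_map hpX.aemeasurable h] with z h1 h2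
    rw [h1, h2]; rfl
  · right
    rw [eventuallyEq_set] at h ⊢
    filter_upwards [hAD, ae_of_ae_map hpX.aemeasurable h] with z h1 h2
    rw [h1, h2]; simp

end
end
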